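/- arXiv:2006.13722 — 8 statements merged into one kernel-verified Lean document; each statement's English description precedes it below -/
import Mathlib

section
/- For every integer k ≥ 1, the minimum size of an edge guard set of the quadrangulation Q_k is exactly k: every edge guard set of Q_k has size at least k, and the k edges sa_1, …, sa_k form an edge guard set of Q_k. -/
namespace Guarding

/-- Vertices of the quadrangulation `Q_k`: two special vertices `s` and `t` together with
vertices `a i`, `b i`, `c i`, `d i` for `i = 0, …, k-1`. -/
inductive QV : Type
  | s : QV
  | t : QV
  | a : ℕ → QV
  | b : ℕ → QV
  | c : ℕ → QV
  | d : ℕ → QV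
  deriving DecidableEq

/-- The edge set of the quadrangulation `Q_k`: the union over `i = 0, …, k-1` of the
edges `sa_i, sc_i, ta_i, tc_i, a_ib_i, a_id_i, c_ib_i, c_id_i`. -/
def Qedges (k : ℕ) : Finset (Sym2 QV) :=
  (Finset.range k).biUnion fun i =>
    {s(QV.s, QV.a i), s(QV.s, QV.c i), s(QV.t, QV.a i), s(QV.t, QV.c i),
     s(QV.a i, QV.b i), s(QV.a i, QV.d i), s(QV.c i, QV.b i), s(QV.c i, QV.d i)}

/-- The faces of `Q_k`, each identified with its 4-element set of boundary vertices:
`{a_i,b_i,c_i,d_i}`, `{s,a_i,b_i,c_i}` and `{t,a_i,d_i,c_i}` for `0 ≤ i ≤ k-1`,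
`{s,c_i,t,a_{i+1}}` for `0 ≤ i ≤ k-2`, and the outer face `{s,a_0,t,c_{k-1}}`. -/
def Qfaces (k : ℕ) : Finset (Finset QV) :=
  ((Finset.range k).biUnion fun i =>
    {{QV.a i, QV.b i, QV.c i, QV.d i},
     {QV.s, QV.a i, QV.b i, QV.c i},
     {QV.t, QV.a i, QV.d i, QV.c i}}) ∪
  ((Finset.range (k - 1)).biUnion fun i => {{QV.s, QV.c i, QV.t, QV.a (i + 1)}}) ∪
  {{QV.s, QV.a 0, QV.t, QV.c (k - 1)}}

/-- `Γ` is an edge guard set of `Q_k`: it is a set of edges of `Q_k` such that every face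
of `Q_k` contains at least one endpoint of some edge of `Γ`. -/
def QGuardSet (k : ℕ) (Γ : Finset (Sym2 QV)) : Prop :=
  Γ ⊆ Qedges k ∧ ∀ f ∈ Qfaces k, ∃ e ∈ Γ, ∃ u ∈ (e : Sym2 QV), u ∈ f

/-- The endpoints of an edge of `Q_k` that lie on quadrilaterals `{a_i, b_i, c_i, d_i}` all lie
on the same one. -/
theorem Qedges_index_unique {k i j : ℕ} {e : Sym2 QV} (he : e ∈ Qedges k)
    (hi : ∃ u ∈ e, u ∈ ({QV.a i, QV.b i, QV.c i, QV.d i} : Finset QV))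
    (hj : ∃ u ∈ e, u ∈ ({QV.a j, QV.b j, QV.c j, QV.d j} : Finset QV)) : i = j := by
  have key : ∀ l, e ∈ ({s(QV.s, QV.a l), s(QV.s, QV.c l), s(QV.t, QV.a l), s(QV.t, QV.c l),
      s(QV.a l, QV.b l), s(QV.a l, QV.d l), s(QV.c l, QV.b l), s(QV.c l, QV.d l)} :
      Finset (Sym2 QV)) → ∀ m, (∃ u ∈ e, u ∈ ({QV.a m, QV.b m, QV.c m, QV.d m} : Finset QV)) →
      m = l := by
    rintro l hl m ⟨u, hu, hm⟩
    simp only [Finset.mem_insert, Finset.mem_singleton] at hl hm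
    rcases hl with rfl | rfl | rfl | rfl | rfl | rfl | rfl | rfl <;>
      rcases hm with rfl | rfl | rfl | rfl <;> simp_all
  obtain ⟨l, -, hl⟩ := Finset.mem_biUnion.mp he
  exact (key l hl i hi).trans (key l hl j hj).symm

/-- For every `k ≥ 1` the minimum size of an edge guard set of the quadrangulation `Q_k`
is exactly `k`: every edge guard set of `Q_k` has size at least `k`, and the `k` edges
`sa_0, …, sa_{k-1}` form an edge guard set of `Q_k`. -/
theorem Qk_min_guards (k : ℕ) (hk : 1 ≤ k) :
    (∀ Γ : Finset (Sym2 QV), QGuardSet k Γ → k ≤ Γ.card) ∧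
    ((Finset.range k).image fun i => s(QV.s, QV.a i)).card = k ∧
    QGuardSet k ((Finset.range k).image fun i => s(QV.s, QV.a i)) := by
  refine ⟨fun Γ hΓ => ?_, ?_, ?_, ?_⟩
  · have h := Finset.card_le_card_of_forall_subsingleton (s := Finset.range k) (t := Γ)
      (fun i e => ∃ u ∈ e, u ∈ ({QV.a i, QV.b i, QV.c i, QV.d i} : Finset QV))
      (fun i hi => hΓ.2 _ (by
        simp only [Qfaces, Finset.mem_union, Finset.mem_biUnion]
        exact .inl (.inl ⟨i, hi, by simp⟩)))
      (fun e he i hi j hj => Qedges_index_unique (hΓ.1 he) hi.2 hj.2)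
    simpa using h
  · rw [Finset.card_image_of_injective _ fun i j h => by simpa using h, Finset.card_range]
  · intro e he
    obtain ⟨i, hi, rfl⟩ := Finset.mem_image.mp he
    exact Finset.mem_biUnion.mpr ⟨i, hi, by simp⟩
  · have guard : ∀ i < k, ∀ f : Finset QV, QV.s ∈ f ∨ QV.a i ∈ f →
        ∃ e ∈ (Finset.range k).image fun i => s(QV.s, QV.a i), ∃ u ∈ e, u ∈ f := by
      intro i hi f hf
      refine ⟨_, Finset.mem_image_of_mem _ (Finset.mem_range.mpr hi), ?_⟩
      rcases hf with hf | hf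
      · exact ⟨_, Sym2.mem_mk_left _ _, hf⟩
      · exact ⟨_, Sym2.mem_mk_right _ _, hf⟩
    intro f hf
    simp only [Qfaces, Finset.mem_union, Finset.mem_biUnion, Finset.mem_insert,
      Finset.mem_singleton, Finset.mem_range] at hf
    rcases hf with (⟨i, hi, rfl | rfl | rfl⟩ | ⟨i, hi, rfl⟩) | rfl
    · exact guard i hi _ (by simp)
    · exact guard i hi _ (by simp)
    · exact guard i hi _ (by simp)
    · exact guard 0 hk _ (by simp)
    · exact guard 0 hk _ (by simp)

end Guarding
end

section
/- For every even integer k ≥ 2 there exists a stacked triangulation G with (7k+4)/2 vertices such that every edge guard set of G has size at least k. -/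
namespace Guarding

/-- `IsStacked V E out F` means: the finite simple graph with vertex set `V`, edge set `E`
(edges as unordered pairs), outer face `out` and set of inner faces `F`
(each face identified with its 3-element set of boundary vertices)
is a stacked triangulation, built by the inductive construction:
the triangle on three vertices is a stacked triangulation whose outer face is `{x,y,z}` and
whose set of inner faces is `{{x,y,z}}`; stacking a new vertex `v` into an inner face
`{x,y,z}` adds the edges `vx, vy, vz` and replaces the face `{x,y,z}` by the three faces
`{v,x,y}, {v,y,z}, {v,z,x}`. -/
inductive IsStacked : Finset ℕ → Finset (Sym2 ℕ) → Finset ℕ → Finset (Finset ℕ) → Prop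
  | base (x y z : ℕ) (hxy : x ≠ y) (hyz : y ≠ z) (hxz : x ≠ z) :
      IsStacked {x, y, z} {s(x, y), s(y, z), s(x, z)} {x, y, z} {{x, y, z}}
  | stack {V : Finset ℕ} {E : Finset (Sym2 ℕ)} {out : Finset ℕ} {F : Finset (Finset ℕ)}
      (x y z v : ℕ) (hG : IsStacked V E out F) (hf : ({x, y, z} : Finset ℕ) ∈ F)
      (hv : v ∉ V) :
      IsStacked (insert v V) (E ∪ {s(v, x), s(v, y), s(v, z)}) out
        ((F.erase {x, y, z}) ∪ {{v, x, y}, {v, y, z}, {v, z, x}})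

/-- The faces of the stacked triangulation: its inner faces together with the outer face. -/
def faces (out : Finset ℕ) (F : Finset (Finset ℕ)) : Finset (Finset ℕ) := insert out F

/-- `V(Γ)`: the set of all endpoints of edges of `Γ`. -/
def gv (Γ : Finset (Sym2 ℕ)) : Set ℕ := {u | ∃ e ∈ Γ, u ∈ e}

/-- `Γ` is an edge guard set: it consists of edges of the graph and every face
contains at least one endpoint of an edge of `Γ`. -/
def IsGuardSet (E : Finset (Sym2 ℕ)) (out : Finset ℕ) (F : Finset (Finset ℕ))
    (Γ : Finset (Sym2 ℕ)) : Prop :=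
  Γ ⊆ E ∧ ∀ f ∈ faces out F, ∃ u ∈ gv Γ, u ∈ f

theorem IsStacked.mem_of_mem_edge_and_subset {V : Finset ℕ} {E : Finset (Sym2 ℕ)} {out : Finset ℕ}
    {F : Finset (Finset ℕ)} (h : IsStacked V E out F) :
    (∀ a b, s(a, b) ∈ E → a ∈ V ∧ b ∈ V) ∧ ∀ f ∈ F, f ⊆ V := by
  induction h with
  | base x y z => refine ⟨?_, ?_⟩ <;> simp; grind
  | @stack V E out F x y z v hG hf hv ih =>
    obtain ⟨ihE, ihF⟩ := ih
    have hxyz := ihF _ hf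
    simp only [Finset.insert_subset_iff, Finset.singleton_subset_iff] at hxyz
    refine ⟨fun a b hab => ?_, fun f hf' => ?_⟩
    · simp only [Finset.mem_union, Finset.mem_insert, Finset.mem_singleton, Sym2.eq_iff] at hab ⊢
      grind
    · simp only [Finset.mem_union, Finset.mem_erase, Finset.mem_insert,
        Finset.mem_singleton] at hf'
      rcases hf' with ⟨-, h⟩ | rfl | rfl | rfl
      · exact (ihF f h).trans (Finset.subset_insert _ _)
      all_goals
        simp only [Finset.insert_subset_iff, Finset.singleton_subset_iff, Finset.mem_insert]
        tauto

theorem IsStacked.out_subset {V : Finset ℕ} {E : Finset (Sym2 ℕ)} {out : Finset ℕ}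
    {F : Finset (Finset ℕ)} (h : IsStacked V E out F) : out ⊆ V := by
  induction h with
  | base => exact subset_rfl
  | stack _ _ _ _ _ _ _ ih => exact ih.trans (Finset.subset_insert _ _)

/-- A stacked triangulation with a vertex labelling `c` such that edges never join two distinct
nonzero labels, and each label in `{1, …, n}` occurs on all vertices of some face. -/
structure IsLabelled (V : Finset ℕ) (E : Finset (Sym2 ℕ)) (out : Finset ℕ)
    (F : Finset (Finset ℕ)) (c : ℕ → ℕ) (n : ℕ) : Prop where
  stacked : IsStacked V E out F
  label_eq : ∀ a b, s(a, b) ∈ E → c a ≠ 0 → c b ≠ 0 → c a = c b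
  exists_face : ∀ j, 1 ≤ j → j ≤ n → ∃ f ∈ faces out F, ∀ u ∈ f, c u = j

section

variable {V : Finset ℕ} {E : Finset (Sym2 ℕ)} {out : Finset ℕ} {F : Finset (Finset ℕ)}
  {c : ℕ → ℕ} {n : ℕ}

theorem IsLabelled.le_card (h : IsLabelled V E out F c n) {Γ : Finset (Sym2 ℕ)}
    (hΓ : IsGuardSet E out F Γ) : n ≤ Γ.card := by
  have key : ∀ j ∈ Finset.Icc 1 n, ∃ e ∈ Γ, ∃ u ∈ e, c u = j := by
    intro j hj
    rw [Finset.mem_Icc] at hj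
    obtain ⟨f, hf, hfj⟩ := h.exists_face j hj.1 hj.2
    obtain ⟨u, ⟨e, he, hue⟩, huf⟩ := hΓ.2 f hf
    exact ⟨e, he, u, hue, hfj u huf⟩
  choose! g hgΓ u hug hcu using key
  have hcard := Finset.card_le_card_of_injOn g hgΓ (fun i hi j hj hij => by
    have hi' := hug i hi
    have hj' := hug j hj
    have hci := hcu i hi
    have hcj := hcu j hj
    rw [Finset.mem_coe, Finset.mem_Icc] at hi hj
    by_cases huv : u i = u j
    · rw [← hci, huv, hcj]
    have hE := hΓ.1 (hgΓ i (Finset.mem_Icc.2 hi))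
    rw [← hij] at hj'
    rw [(Sym2.mem_and_mem_iff huv).1 ⟨hi', hj'⟩] at hE
    rw [← hci, ← hcj]
    exact h.label_eq _ _ hE (by omega) (by omega))
  simpa using hcard

/-- Stacking a vertex `v` with a label `i` compatible with the labels of the subdivided face,
which should not be one of the monochromatic inner faces that are counted. -/
theorem IsLabelled.stack (h : IsLabelled V E out F c n) {x y z v i : ℕ}
    (hf : ({x, y, z} : Finset ℕ) ∈ F) (hv : v ∉ V)
    (hc : ∀ a ∈ ({x, y, z} : Finset ℕ), i = 0 ∨ c a = 0 ∨ c a = i)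
    (hzero : ({x, y, z} : Finset ℕ) = out ∨ ∃ a ∈ ({x, y, z} : Finset ℕ), c a = 0) :
    IsLabelled (insert v V) (E ∪ {s(v, x), s(v, y), s(v, z)}) out
      ((F.erase {x, y, z}) ∪ {{v, x, y}, {v, y, z}, {v, z, x}}) (Function.update c v i) n := by
  obtain ⟨hEV, hFV⟩ := h.stacked.mem_of_mem_edge_and_subset
  have hupd : ∀ a ∈ V, Function.update c v i a = c a := fun a ha =>
    Function.update_of_ne (by rintro rfl; exact hv ha) _ _
  refine ⟨.stack x y z v h.stacked hf hv, fun a b hab => ?_, fun j hj hjn => ?_⟩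
  · rw [Finset.mem_union] at hab
    rcases hab with hab | hab
    · rw [hupd a (hEV a b hab).1, hupd b (hEV a b hab).2]
      exact h.label_eq a b hab
    · have hnew : ∀ t ∈ ({x, y, z} : Finset ℕ), s(a, b) = s(v, t) →
          Function.update c v i a ≠ 0 → Function.update c v i b ≠ 0 →
          Function.update c v i a = Function.update c v i b := by
        intro t ht hst
        have hct := hc t ht
        have ht' := hupd t (hFV _ hf ht)
        rcases Sym2.eq_iff.1 hst with ⟨rfl, rfl⟩ | ⟨rfl, rfl⟩ <;>
          rw [ht', Function.update_self] <;> omega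
      simp only [Finset.mem_insert, Finset.mem_singleton] at hab
      rcases hab with hab | hab | hab
      · exact hnew x (by simp) hab
      · exact hnew y (by simp) hab
      · exact hnew z (by simp) hab
  · obtain ⟨f, hfF, hfj⟩ := h.exists_face j hj hjn
    have hfV : f ⊆ V := by
      rcases Finset.mem_insert.1 hfF with rfl | hfF
      exacts [h.stacked.out_subset, hFV f hfF]
    refine ⟨f, ?_, fun u hu => (hupd u (hfV hu)).trans (hfj u hu)⟩
    by_cases hout : f = out
    · exact hout ▸ Finset.mem_insert_self _ _
    have hne : f ≠ {x, y, z} := by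
      rintro rfl
      obtain ⟨a, ha, ha0⟩ := hzero.resolve_left hout
      have := hfj a ha
      omega
    exact Finset.mem_insert_of_mem (Finset.mem_union_left _
      (Finset.mem_erase.2 ⟨hne, (Finset.mem_insert.1 hfF).resolve_left hout⟩))

/-- Stacking three new pairwise adjacent vertices with the same label into a face, so that they
bound a new face. -/
theorem IsLabelled.stack_triangle (h : IsLabelled V E out F c n) {x y z i : ℕ}
    (hxy : x ≠ y) (hf : ({x, y, z} : Finset ℕ) ∈ F)
    (hc : ∀ a ∈ ({x, y, z} : Finset ℕ), i = 0 ∨ c a = 0)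
    (hzero : ({x, y, z} : Finset ℕ) = out ∧ i = 0 ∨ c x = 0) :
    ∃ V' E' F' c' p q r, IsLabelled V' E' out F' c' n ∧ V'.card = V.card + 3 ∧ V ⊆ V' ∧
      (∀ a ∈ V, c' a = c a) ∧ F.erase {x, y, z} ⊆ F' ∧ ({p, q, r} : Finset ℕ) ∈ F' ∧
      p ≠ q ∧ q ≠ r ∧ p ≠ r ∧ c' p = i ∧ c' q = i ∧ c' r = i := by
  have hFV := h.stacked.mem_of_mem_edge_and_subset.2
  have hxV : x ∈ V := hFV _ hf (by simp)
  have hyV : y ∈ V := hFV _ hf (by simp)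
  obtain ⟨r, hr⟩ := Infinite.exists_notMem_finset V
  obtain ⟨q, hq⟩ := Infinite.exists_notMem_finset (insert r V)
  obtain ⟨p, hp⟩ := Infinite.exists_notMem_finset (insert q (insert r V))
  have hrx : x ≠ r := fun e => hr (e ▸ hxV)
  have hry : y ≠ r := fun e => hr (e ▸ hyV)
  have hqx : x ≠ q := fun e => hq (e ▸ Finset.mem_insert_of_mem hxV)
  have hqr : r ≠ q := fun e => hq (e ▸ Finset.mem_insert_self _ _)
  have hpq : p ≠ q := by grind
  have hpr : p ≠ r := by grind
  have h₁ := h.stack (i := i) hf hr (by grind) (by grind)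
  have h₂ := h₁.stack (x := r) (y := x) (z := y) (v := q) (i := i) (by simp) hq
    (by simp [Function.update_of_ne hrx, Function.update_of_ne hry]; grind)
    (by simp [Function.update_of_ne hrx, Function.update_of_ne hry]; grind)
  have h₃ := h₂.stack (x := q) (y := r) (z := x) (v := p) (i := i) (by simp) hp
    (by simp [Function.update_of_ne hrx, Function.update_of_ne hqx,
          Function.update_of_ne hqr]; grind)
    (by simp [Function.update_of_ne hrx, Function.update_of_ne hqx,
          Function.update_of_ne hqr]; grind)
  refine ⟨_, _, _, _, p, q, r, h₃, ?_, by grind, ?_, ?_, by simp, hpq, hqr.symm, hpr, ?_, ?_, ?_⟩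
  · rw [Finset.card_insert_of_notMem hp, Finset.card_insert_of_notMem hq,
      Finset.card_insert_of_notMem hr]
  · intro a ha
    have hap : a ≠ p := fun e => hp (e ▸ by simp [ha])
    have haq : a ≠ q := fun e => hq (e ▸ by simp [ha])
    have har : a ≠ r := fun e => hr (e ▸ ha)
    simp [hap, haq, har]
  · intro g hg
    have hgV := hFV g (Finset.mem_of_mem_erase hg)
    have h₁ : g ≠ {r, x, y} := by
      rintro rfl
      exact hr (hgV (by simp))
    have h₂ : g ≠ {q, r, x} := by
      rintro rfl
      exact hr (hgV (by simp))
    simp only [Finset.mem_union, Finset.mem_erase] at hg ⊢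
    tauto
  all_goals simp [hqr, hpq.symm, hpr.symm]

/-- Stacking a monochromatic triangle with the next label into a face with labels `0`. -/
theorem IsLabelled.exists_succ (h : IsLabelled V E out F c n) {x y z : ℕ} (hxy : x ≠ y)
    (hf : ({x, y, z} : Finset ℕ) ∈ F) (hx : c x = 0) (hy : c y = 0) (hz : c z = 0) :
    ∃ V' E' F' c', IsLabelled V' E' out F' c' (n + 1) ∧ V'.card = V.card + 3 ∧ V ⊆ V' ∧
      (∀ a ∈ V, c' a = c a) ∧ F.erase {x, y, z} ⊆ F' := by
  obtain ⟨V', E', F', c', p, q, r, h', hcard, hV, hc, hF, hpqr, -, -, -, hp, hq, hr⟩ :=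
    h.stack_triangle (i := n + 1) hxy hf (by simp [hx, hy, hz]) (.inr hx)
  refine ⟨V', E', F', c', ⟨h'.stacked, h'.label_eq, fun j hj hjn => ?_⟩, hcard, hV, hc, hF⟩
  rcases Nat.lt_or_ge n j with hlt | hle
  · obtain rfl : j = n + 1 := by omega
    exact ⟨_, Finset.mem_insert_of_mem hpqr, by simp [hp, hq, hr]⟩
  · exact h'.exists_face j hj hle

end

theorem exists_isLabelled_with_zero_face (m : ℕ) :
    ∃ V E out F c x y z, IsLabelled V E out F c (2 * m + 1) ∧ V.card = 7 * m + 6 ∧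
      ({x, y, z} : Finset ℕ) ∈ F ∧ x ≠ y ∧ y ≠ z ∧ x ≠ z ∧ c x = 0 ∧ c y = 0 ∧ c z = 0 := by
  induction m with
  | zero =>
    have h : IsLabelled {0, 1, 2} {s(0, 1), s(1, 2), s(0, 2)} {0, 1, 2} {{0, 1, 2}}
        (fun _ => 1) 1 :=
      ⟨.base 0 1 2 (by simp) (by simp) (by simp), fun _ _ _ _ _ => rfl,
        fun j _ _ => ⟨_, Finset.mem_insert_self _ _, fun _ _ => by omega⟩⟩
    obtain ⟨V', E', F', c', p, q, r, h', hcard, -, -, -, hpqr, hpq, hqr, hpr, hp, hq, hr⟩ :=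
      h.stack_triangle (x := 0) (y := 1) (z := 2) (i := 0) (by simp) (by simp) (by simp)
        (by simp)
    exact ⟨V', E', _, F', c', p, q, r, h', by simpa using hcard, hpqr, hpq, hqr, hpr, hp, hq, hr⟩
  | succ m ih =>
    obtain ⟨V, E, out, F, c, x, y, z, h, hcard, hf, hxy, hyz, hxz, hx, hy, hz⟩ := ih
    have hfV := h.stacked.mem_of_mem_edge_and_subset.2 _ hf
    obtain ⟨w, hw⟩ := Infinite.exists_notMem_finset V
    have hwx : x ≠ w := fun e => hw (e ▸ hfV (by simp))
    have hwy : y ≠ w := fun e => hw (e ▸ hfV (by simp))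
    have hwz : z ≠ w := fun e => hw (e ▸ hfV (by simp))
    have h₁ := h.stack (i := 0) hf hw (by simp) (.inr ⟨x, by simp, hx⟩)
    obtain ⟨V₂, E₂, F₂, c₂, h₂, hcard₂, hV₂, hc₂, hF₂⟩ := h₁.exists_succ (x := w) (y := x) (z := y)
      hwx.symm (by simp) (by simp) (by simp [hx, hwx]) (by simp [hy, hwy])
    have hne₁ : ({w, y, z} : Finset ℕ) ≠ {w, x, y} := fun e => by
      have : z ∈ ({w, x, y} : Finset ℕ) := e ▸ (by simp)
      simp at this
      tauto
    have hne₂ : ({w, z, x} : Finset ℕ) ≠ {w, x, y} := fun e => by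
      have : z ∈ ({w, x, y} : Finset ℕ) := e ▸ (by simp)
      simp at this
      tauto
    have hne₃ : ({w, z, x} : Finset ℕ) ≠ {w, y, z} := fun e => by
      have : x ∈ ({w, y, z} : Finset ℕ) := e ▸ (by simp)
      simp at this
      tauto
    have hwyz : ({w, y, z} : Finset ℕ) ∈ F₂ := hF₂ (Finset.mem_erase.2 ⟨hne₁, by simp⟩)
    have hwzx : ({w, z, x} : Finset ℕ) ∈ F₂ := hF₂ (Finset.mem_erase.2 ⟨hne₂, by simp⟩)
    have hw₂ : c₂ w = 0 := by rw [hc₂ w (by simp)]; simp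
    have hx₂ : c₂ x = 0 := by
      rw [hc₂ x (Finset.mem_insert_of_mem (hfV (by simp)))]; simp [hx, hwx]
    have hy₂ : c₂ y = 0 := by
      rw [hc₂ y (Finset.mem_insert_of_mem (hfV (by simp)))]; simp [hy, hwy]
    have hz₂ : c₂ z = 0 := by
      rw [hc₂ z (Finset.mem_insert_of_mem (hfV (by simp)))]; simp [hz, hwz]
    obtain ⟨V₃, E₃, F₃, c₃, h₃, hcard₃, -, hc₃, hF₃⟩ :=
      h₂.exists_succ hwy.symm hwyz hw₂ hy₂ hz₂
    have hwzxV := h₂.stacked.mem_of_mem_edge_and_subset.2 _ hwzx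
    refine ⟨V₃, E₃, out, F₃, c₃, w, z, x, h₃, ?_, hF₃ (Finset.mem_erase.2 ⟨hne₃, hwzx⟩), hwz.symm,
      hxz.symm, hwx.symm, (hc₃ w (hwzxV (by simp))).trans hw₂,
      (hc₃ z (hwzxV (by simp))).trans hz₂, (hc₃ x (hwzxV (by simp))).trans hx₂⟩
    rw [hcard₃, hcard₂, Finset.card_insert_of_notMem hw, hcard]
    ring

/-- For every even integer `k ≥ 2` there exists a stacked triangulation `G` with
`(7k+4)/2` vertices such that every edge guard set of `G` has size at least `k`. -/
theorem stacked_lower_bound (k : ℕ) (hk : 2 ≤ k) (hke : Even k) :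
    ∃ (V : Finset ℕ) (E : Finset (Sym2 ℕ)) (out : Finset ℕ) (F : Finset (Finset ℕ)),
      IsStacked V E out F ∧ 2 * V.card = 7 * k + 4 ∧
      ∀ Γ : Finset (Sym2 ℕ), IsGuardSet E out F Γ → k ≤ Γ.card := by
  obtain ⟨t, rfl⟩ := hke
  obtain ⟨m, rfl⟩ : ∃ m, t = m + 1 := ⟨t - 1, by omega⟩
  obtain ⟨V, E, out, F, c, x, y, z, h, hcard, hf, hxy, -, -, hx, hy, hz⟩ :=
    exists_isLabelled_with_zero_face m
  obtain ⟨V', E', F', c', h', hcard', -⟩ := h.exists_succ hxy hf hx hy hz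
  refine ⟨V', E', out, F', h'.stacked, by omega, fun Γ hΓ => ?_⟩
  have := h'.le_card hΓ
  omega

end Guarding
end

section
/- Every stacked triangulation with n ≥ 4 vertices has an edge guard set of size at most ⌊2n/7⌋. -/
namespace Guarding

theorem ne_of_card_eq_three {x y z : ℕ} (h : ({x, y, z} : Finset ℕ).card = 3) :
    x ≠ y ∧ x ≠ z ∧ y ≠ z := by
  refine ⟨?_, ?_, ?_⟩ <;> rintro rfl <;> simp at h <;>
    exact absurd h (Finset.card_le_two.trans_lt (by decide)).ne

/-- The recursive structure of a triangle subdivided by stacking vertices: either nothing is stacked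
into it, or `v` is stacked into it and the three resulting triangles are subdivided further. -/
inductive Subdivision : Type
  | leaf : Subdivision
  | node (v : ℕ) (t₁ t₂ t₃ : Subdivision) : Subdivision

namespace Subdivision

/-- The number of stacked vertices. -/
def size : Subdivision → ℕ
  | leaf => 0
  | node _ t₁ t₂ t₃ => t₁.size + t₂.size + t₃.size + 1

/-- The inner faces of the subdivided triangle `xyz`. -/
def faces : Subdivision → ℕ → ℕ → ℕ → Finset (Finset ℕ)
  | leaf, x, y, z => {{x, y, z}}
  | node v t₁ t₂ t₃, x, y, z => t₁.faces v x y ∪ t₂.faces v y z ∪ t₃.faces v z x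

/-- The edges of the subdivided triangle `xyz`, including its three sides. -/
def edges : Subdivision → ℕ → ℕ → ℕ → Finset (Sym2 ℕ)
  | leaf, x, y, z => {s(x, y), s(y, z), s(x, z)}
  | node v t₁ t₂ t₃, x, y, z => t₁.edges v x y ∪ t₂.edges v y z ∪ t₃.edges v z x

/-- Stacking a further vertex into an inner face. -/
theorem exists_stack (t : Subdivision) (x y z v : ℕ) {f : Finset ℕ} (hf : f ∈ t.faces x y z)
    (hcard : f.card = 3) :
    ∃ t' : Subdivision, t'.size = t.size + 1 ∧
      (∀ e ∈ t'.edges x y z, e ∈ t.edges x y z ∨ ∃ u ∈ f, e = s(v, u)) ∧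
      (∀ g ∈ t.faces x y z, g ≠ f → g ∈ t'.faces x y z) ∧
      ∀ u ∈ f, insert v (f.erase u) ∈ t'.faces x y z := by
  induction t generalizing x y z with
  | leaf =>
    obtain rfl : f = {x, y, z} := by simpa [faces] using hf
    obtain ⟨hxy, hxz, hyz⟩ := ne_of_card_eq_three hcard
    refine ⟨node v leaf leaf leaf, rfl, ?_, ?_, ?_⟩
    · simp only [edges]
      grind
    · simp [faces]
    · intro u hu
      simp only [faces, Finset.mem_union, Finset.mem_singleton]
      simp only [Finset.mem_insert, Finset.mem_singleton] at hu
      rcases hu with rfl | rfl | rfl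
      · exact .inl (.inr (congrArg _ (by grind)))
      · exact .inr (congrArg _ (by grind))
      · exact .inl (.inl (congrArg _ (by grind)))
  | node w t₁ t₂ t₃ ih₁ ih₂ ih₃ =>
    simp only [faces, Finset.mem_union] at hf
    rcases hf with (hf | hf) | hf
    · obtain ⟨t', hs, he, hg, hn⟩ := ih₁ _ _ _ hf
      refine ⟨node w t' t₂ t₃, ?_, ?_, ?_, ?_⟩ <;> simp only [size, edges, faces] <;> grind
    · obtain ⟨t', hs, he, hg, hn⟩ := ih₂ _ _ _ hf
      refine ⟨node w t₁ t' t₃, ?_, ?_, ?_, ?_⟩ <;> simp only [size, edges, faces] <;> grind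
    · obtain ⟨t', hs, he, hg, hn⟩ := ih₃ _ _ _ hf
      refine ⟨node w t₁ t₂ t', ?_, ?_, ?_, ?_⟩ <;> simp only [size, edges, faces] <;> grind

end Subdivision

theorem IsStacked.card_of_mem {V : Finset ℕ} {E : Finset (Sym2 ℕ)} {out : Finset ℕ}
    {F : Finset (Finset ℕ)} (hG : IsStacked V E out F) :
    ∀ f ∈ F, f.card = 3 ∧ f ⊆ V := by
  induction hG with
  | base x y z hxy hyz hxz => simp [Finset.card_eq_three]; exact ⟨x, y, hxy, z, hxz, hyz, rfl⟩
  | stack x y z v _ hf hv ih =>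
    have hxyz := ih _ hf
    have hne := ne_of_card_eq_three hxyz.1
    intro f hf'
    simp only [Finset.mem_union, Finset.mem_erase, Finset.mem_insert, Finset.mem_singleton] at hf'
    rcases hf' with ⟨-, hf'⟩ | rfl | rfl | rfl
    · exact ⟨(ih f hf').1, (ih f hf').2.trans (Finset.subset_insert _ _)⟩
    all_goals
      refine ⟨Finset.card_eq_three.2 ⟨_, _, _, ?_, ?_, ?_, rfl⟩, ?_⟩ <;> grind

/-- A stacked triangulation is a subdivision of its outer face. -/
theorem IsStacked.exists_subdivision {V : Finset ℕ} {E : Finset (Sym2 ℕ)} {out : Finset ℕ}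
    {F : Finset (Finset ℕ)} (hG : IsStacked V E out F) :
    ∃ (t : Subdivision) (x y z : ℕ), out = {x, y, z} ∧ t.edges x y z ⊆ E ∧ F ⊆ t.faces x y z ∧
      V.card = t.size + 3 := by
  induction hG with
  | base x y z hxy hyz hxz =>
    exact ⟨.leaf, x, y, z, rfl, subset_rfl, subset_rfl,
      Finset.card_eq_three.2 ⟨x, y, z, hxy, hxz, hyz, rfl⟩⟩
  | stack a b c v hG hf hv ih =>
    obtain ⟨t, x, y, z, hout, hE, hF, hcard⟩ := ih
    have h3 := (hG.card_of_mem _ hf).1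
    obtain ⟨hab, hac, hbc⟩ := ne_of_card_eq_three h3
    obtain ⟨t', hs, he, hg, hn⟩ := t.exists_stack x y z v (hF hf) h3
    refine ⟨t', x, y, z, hout, fun e h => ?_, fun f h => ?_, ?_⟩
    · rcases he e h with h | ⟨u, hu, rfl⟩
      · exact Finset.mem_union_left _ (hE h)
      · grind
    · simp only [Finset.mem_union, Finset.mem_erase, Finset.mem_insert,
        Finset.mem_singleton] at h
      rcases h with ⟨hne, h⟩ | rfl | rfl | rfl
      · exact hg f (hF h) hne
      · convert hn c (by simp) using 2; grind
      · convert hn a (by simp) using 2; grind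
      · convert hn b (by simp) using 2; grind
    · rw [Finset.card_insert_of_notMem hv, hcard, hs]

/-- The role of a corner of a triangle when guarding the inside of the triangle:
it is promised to be an endpoint of a guard from elsewhere, or it is not, or
it is demanded to be an endpoint of a guard used inside the triangle. -/
inductive Role : Type
  | promised | free | demanded

open Role

namespace Role

/-- All roles. -/
def all : List Role := [promised, free, demanded]

theorem mem_all (a : Role) : a ∈ all := by cases a <;> simp [all]

/-- The ways to pass a role on to two triangles sharing the vertex. -/
def splits : Role → List (Role × Role)
  | promised => [(promised, promised)]
  | free => [(free, free), (demanded, promised), (promised, demanded)]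
  | demanded => [(demanded, promised), (promised, demanded)]

/-- The ways to give roles to a stacked vertex in the three triangles around it. -/
def shares : List (Role × Role × Role) :=
  [(free, free, free), (demanded, promised, promised), (promised, demanded, promised),
    (promised, promised, demanded)]

end Role

theorem gv_mono {Γ Γ' : Finset (Sym2 ℕ)} (h : Γ ⊆ Γ') : gv Γ ⊆ gv Γ' :=
  fun _ ⟨e, he, hu⟩ => ⟨e, h he, hu⟩

namespace Subdivision

/-- At most `k` edges guard the inside of the triangle `xyz` when the corners have the roles
`a`, `b` and `c`. -/
def Guards (t : Subdivision) (x y z : ℕ) (a b c : Role) (k : ℕ) : Prop :=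
  ∃ Γ ⊆ t.edges x y z, Γ.card ≤ k ∧
    (a = demanded → x ∈ gv Γ) ∧ (b = demanded → y ∈ gv Γ) ∧ (c = demanded → z ∈ gv Γ) ∧
    ∀ f ∈ t.faces x y z, ∃ u ∈ f, u ∈ gv Γ ∨
      (a = promised ∧ u = x) ∨ (b = promised ∧ u = y) ∨ (c = promised ∧ u = z)

theorem Guards.mono {t : Subdivision} {x y z : ℕ} {a b c : Role} {k l : ℕ}
    (h : t.Guards x y z a b c k) (hkl : k ≤ l) : t.Guards x y z a b c l := by
  obtain ⟨Γ, h₁, h₂, h₃⟩ := h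
  exact ⟨Γ, h₁, h₂.trans hkl, h₃⟩

theorem Guards.node {t₁ t₂ t₃ : Subdivision} {v x y z : ℕ} {a b c : Role}
    {p q r : Role × Role} {s : Role × Role × Role} {k₁ k₂ k₃ : ℕ}
    (hp : p ∈ a.splits) (hq : q ∈ b.splits) (hr : r ∈ c.splits) (hs : s ∈ Role.shares)
    (h₁ : t₁.Guards v x y s.1 p.1 q.1 k₁) (h₂ : t₂.Guards v y z s.2.1 q.2 r.1 k₂)
    (h₃ : t₃.Guards v z x s.2.2 r.2 p.2 k₃) :
    (node v t₁ t₂ t₃).Guards x y z a b c (k₁ + k₂ + k₃) := by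
  obtain ⟨Γ₁, he₁, hk₁, hv₁, hx₁, hy₁, hf₁⟩ := h₁
  obtain ⟨Γ₂, he₂, hk₂, hv₂, hy₂, hz₂, hf₂⟩ := h₂
  obtain ⟨Γ₃, he₃, hk₃, hv₃, hz₃, hx₃, hf₃⟩ := h₃
  have i₁ : gv Γ₁ ⊆ gv (Γ₁ ∪ Γ₂ ∪ Γ₃) := gv_mono (by grind)
  have i₂ : gv Γ₂ ⊆ gv (Γ₁ ∪ Γ₂ ∪ Γ₃) := gv_mono (by grind)
  have i₃ : gv Γ₃ ⊆ gv (Γ₁ ∪ Γ₂ ∪ Γ₃) := gv_mono (by grind)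
  have split {w : ℕ} {d : Role} {m : Role × Role} (hm : m ∈ d.splits)
      (hw₁ : m.1 = demanded → w ∈ gv (Γ₁ ∪ Γ₂ ∪ Γ₃))
      (hw₂ : m.2 = demanded → w ∈ gv (Γ₁ ∪ Γ₂ ∪ Γ₃)) :
      (d = demanded → w ∈ gv (Γ₁ ∪ Γ₂ ∪ Γ₃)) ∧
        (m.1 = promised ∨ m.2 = promised → d = promised ∨ w ∈ gv (Γ₁ ∪ Γ₂ ∪ Γ₃)) := by
    cases d <;> simp only [Role.splits, List.mem_cons, List.not_mem_nil, or_false] at hm <;>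
      grind
  have hx := split hp (i₁ <| hx₁ ·) (i₃ <| hx₃ ·)
  have hy := split hq (i₁ <| hy₁ ·) (i₂ <| hy₂ ·)
  have hz := split hr (i₂ <| hz₂ ·) (i₃ <| hz₃ ·)
  have hv : s.1 = promised ∨ s.2.1 = promised ∨ s.2.2 = promised →
      v ∈ gv (Γ₁ ∪ Γ₂ ∪ Γ₃) := by
    simp only [Role.shares, List.mem_cons, List.not_mem_nil, or_false] at hs
    rcases hs with rfl | rfl | rfl | rfl
    · simp
    · exact fun _ => i₁ (hv₁ rfl)
    · exact fun _ => i₂ (hv₂ rfl)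
    · exact fun _ => i₃ (hv₃ rfl)
  refine ⟨Γ₁ ∪ Γ₂ ∪ Γ₃, ?_, ?_, hx.1, hy.1, hz.1, fun f hf => ?_⟩
  · exact Finset.union_subset_union (Finset.union_subset_union he₁ he₂) he₃
  · have := Finset.card_union_le (Γ₁ ∪ Γ₂) Γ₃
    have := Finset.card_union_le Γ₁ Γ₂
    omega
  · simp only [faces, Finset.mem_union] at hf
    rcases hf with (hf | hf) | hf
    · obtain ⟨u, hu, h⟩ := hf₁ f hf
      have := @i₁ u
      exact ⟨u, hu, by grind⟩
    · obtain ⟨u, hu, h⟩ := hf₂ f hf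
      have := @i₂ u
      exact ⟨u, hu, by grind⟩
    · obtain ⟨u, hu, h⟩ := hf₃ f hf
      have := @i₃ u
      exact ⟨u, hu, by grind⟩

end Subdivision

/-- The extremal behaviours of subdivided triangles, modelled on those with at most three stacked
vertices. The constructors `two₁`, `two₂`, `two₃` differ by the order of the corners, and so do
`three₁`, `three₂`, `three₃`. -/
inductive Shape : Type
  | zero | one | two₁ | two₂ | two₃ | three₁ | three₂ | three₃

namespace Shape

/-- All shapes. -/
def all : List Shape := [zero, one, two₁, two₂, two₃, three₁, three₂, three₃]

theorem mem_all (σ : Shape) : σ ∈ all := by cases σ <;> simp [all]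

/-- Twice the number of stacked vertices. -/
def weight : Shape → ℕ
  | zero => 0
  | one => 2
  | two₁ | two₂ | two₃ => 4
  | three₁ | three₂ | three₃ => 6

/-- The number of guards for two stacked vertices, where the last corner lies on only one of
the small triangles around the second vertex. -/
def costTwo : Role → Role → Role → ℕ
  | _, promised, demanded => 1
  | promised, _, demanded => 1
  | _, _, demanded => 2
  | promised, promised, _ => 0
  | _, _, _ => 1

/-- The number of guards for three stacked vertices, where all guards can be placed at the first
corner. -/
def costThree : Role → Role → Role → ℕ
  | _, demanded, demanded => 2
  | promised, _, _ => 1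
  | _, demanded, _ => 2
  | _, _, demanded => 2
  | _, _, _ => 1

/-- The number of guards needed when the corners have the given roles. -/
def cost : Shape → Role → Role → Role → ℕ
  | zero, free, free, free => 1
  | zero, demanded, demanded, demanded => 2
  | zero, demanded, _, _ => 1
  | zero, _, demanded, _ => 1
  | zero, _, _, demanded => 1
  | zero, _, _, _ => 0
  | one, promised, promised, free => 0
  | one, promised, free, promised => 0
  | one, free, promised, promised => 0
  | one, promised, promised, promised => 0
  | one, demanded, demanded, demanded => 2
  | one, _, _, _ => 1
  | two₁, a, b, c => costTwo b c a
  | two₂, a, b, c => costTwo a c b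
  | two₃, a, b, c => costTwo a b c
  | three₁, a, b, c => costThree a b c
  | three₂, a, b, c => costThree b a c
  | three₃, a, b, c => costThree c a b

/-- Stacking a vertex and subdividing the three triangles around it with shapes `σ₁`, `σ₂`, `σ₃`
behaves at worst like the shape `τ` with `e` additional guards. -/
def reduces (σ₁ σ₂ σ₃ τ : Shape) (e : ℕ) : Bool :=
  Role.all.all fun a => Role.all.all fun b => Role.all.all fun c =>
    a.splits.any fun p => b.splits.any fun q => c.splits.any fun r => Role.shares.any fun s =>
      (σ₁.cost s.1 p.1 q.1 + σ₂.cost s.2.1 q.2 r.1 + σ₃.cost s.2.2 r.2 p.2).ble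
        (τ.cost a b c + e)

theorem exists_cost_eq_one (σ : Shape) : σ.cost demanded free free = 1 ∨
    σ.cost free demanded free = 1 ∨ σ.cost free free demanded = 1 := by
  cases σ <;> decide

theorem exists_reduces (σ₁ σ₂ σ₃ : Shape) :
    ∃ (τ : Shape) (e : ℕ), max 1 τ.weight + 7 * e ≤ σ₁.weight + σ₂.weight + σ₃.weight + 2 ∧
      reduces σ₁ σ₂ σ₃ τ e = true := by
  have h : (all.all fun σ₁ => all.all fun σ₂ => all.all fun σ₃ => [2, 1, 0].any fun e =>
      all.any fun τ => (max 1 τ.weight + 7 * e).ble (σ₁.weight + σ₂.weight + σ₃.weight + 2) &&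
        reduces σ₁ σ₂ σ₃ τ e) = true := by
    decide +kernel
  simp only [List.all_eq_true, List.any_eq_true, Bool.and_eq_true, Nat.ble_eq] at h
  obtain ⟨e, -, τ, -, h⟩ := h σ₁ σ₁.mem_all σ₂ σ₂.mem_all σ₃ σ₃.mem_all
  exact ⟨τ, e, h⟩

theorem exists_of_reduces {σ₁ σ₂ σ₃ τ : Shape} {e : ℕ} (h : reduces σ₁ σ₂ σ₃ τ e = true)
    (a b c : Role) :
    ∃ p ∈ a.splits, ∃ q ∈ b.splits, ∃ r ∈ c.splits, ∃ s ∈ Role.shares,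
      σ₁.cost s.1 p.1 q.1 + σ₂.cost s.2.1 q.2 r.1 + σ₃.cost s.2.2 r.2 p.2 ≤ τ.cost a b c + e := by
  simp only [reduces, List.all_eq_true, List.any_eq_true, Nat.ble_eq] at h
  exact h a a.mem_all b b.mem_all c c.mem_all

end Shape

namespace Subdivision

/-- The subdivision needs at most `e` guards more than the shape `σ`. -/
def Behaves (t : Subdivision) (σ : Shape) (e : ℕ) : Prop :=
  ∀ (x y z : ℕ) (a b c : Role), t.Guards x y z a b c (σ.cost a b c + e)

theorem behaves_leaf : leaf.Behaves .zero 0 := by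
  intro x y z a b c
  cases a <;> cases b <;> cases c <;>
    first
    | (refine ⟨∅, ?_⟩; simp [Shape.cost, faces, gv]; done)
    | (refine ⟨{s(x, y)}, ?_⟩; simp [Shape.cost, faces, edges, gv]; done)
    | (refine ⟨{s(y, z)}, ?_⟩; simp [Shape.cost, faces, edges, gv]; done)
    | (refine ⟨{s(x, z)}, ?_⟩; simp [Shape.cost, faces, edges, gv]; done)
    | exact ⟨{s(x, y), s(y, z)}, by grind [edges], Finset.card_le_two, by simp [faces, gv]⟩

theorem Behaves.exists_node {t₁ t₂ t₃ : Subdivision} {σ₁ σ₂ σ₃ : Shape} {e₁ e₂ e₃ : ℕ} (v : ℕ)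
    (h₁ : t₁.Behaves σ₁ e₁) (h₂ : t₂.Behaves σ₂ e₂) (h₃ : t₃.Behaves σ₃ e₃)
    (hw₁ : σ₁.weight + 7 * e₁ ≤ 2 * t₁.size) (hw₂ : σ₂.weight + 7 * e₂ ≤ 2 * t₂.size)
    (hw₃ : σ₃.weight + 7 * e₃ ≤ 2 * t₃.size) :
    ∃ τ e, max 1 τ.weight + 7 * e ≤ 2 * (node v t₁ t₂ t₃).size ∧
      (node v t₁ t₂ t₃).Behaves τ e := by
  obtain ⟨τ, e, hw, h⟩ := Shape.exists_reduces σ₁ σ₂ σ₃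
  refine ⟨τ, e + e₁ + e₂ + e₃, ?_, fun x y z a b c => ?_⟩
  · simp only [size]
    omega
  · obtain ⟨p, hp, q, hq, r, hr, s, hs, hle⟩ := Shape.exists_of_reduces h a b c
    exact (Guards.node hp hq hr hs (h₁ ..) (h₂ ..) (h₃ ..)).mono (by omega)

theorem exists_behaves (t : Subdivision) :
    ∃ σ e, σ.weight + 7 * e ≤ 2 * t.size ∧ (0 < t.size → 1 + 7 * e ≤ 2 * t.size) ∧
      t.Behaves σ e := by
  induction t with
  | leaf => exact ⟨.zero, 0, by simp [Shape.weight], by simp [size], behaves_leaf⟩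
  | node v t₁ t₂ t₃ ih₁ ih₂ ih₃ =>
    obtain ⟨σ₁, e₁, hw₁, -, h₁⟩ := ih₁
    obtain ⟨σ₂, e₂, hw₂, -, h₂⟩ := ih₂
    obtain ⟨σ₃, e₃, hw₃, -, h₃⟩ := ih₃
    obtain ⟨τ, e, hw, h⟩ := h₁.exists_node v h₂ h₃ hw₁ hw₂ hw₃
    exact ⟨τ, e, by omega, by omega, h⟩

theorem exists_guards (t : Subdivision) (ht : 0 < t.size) (x y z : ℕ) :
    ∃ Γ ⊆ t.edges x y z, 7 * Γ.card ≤ 2 * (t.size + 3) ∧ (x ∈ gv Γ ∨ y ∈ gv Γ ∨ z ∈ gv Γ) ∧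
      ∀ f ∈ t.faces x y z, ∃ u ∈ gv Γ, u ∈ f := by
  obtain ⟨σ, e, -, hw, h⟩ := t.exists_behaves
  have hw := hw ht
  rcases σ.exists_cost_eq_one with hσ | hσ | hσ
  · obtain ⟨Γ, hE, hk, hx, -, -, hf⟩ := h x y z demanded free free
    exact ⟨Γ, hE, by omega, .inl (hx rfl), by simpa [and_comm] using hf⟩
  · obtain ⟨Γ, hE, hk, -, hy, -, hf⟩ := h x y z free demanded free
    exact ⟨Γ, hE, by omega, .inr (.inl (hy rfl)), by simpa [and_comm] using hf⟩
  · obtain ⟨Γ, hE, hk, -, -, hz, hf⟩ := h x y z free free demanded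
    exact ⟨Γ, hE, by omega, .inr (.inr (hz rfl)), by simpa [and_comm] using hf⟩

end Subdivision

/-- Every stacked triangulation with `n ≥ 4` vertices has an edge guard set of size
at most `⌊2n/7⌋`. -/
theorem stacked_upper_bound (V : Finset ℕ) (E : Finset (Sym2 ℕ)) (out : Finset ℕ)
    (F : Finset (Finset ℕ)) (hG : IsStacked V E out F) (hn : 4 ≤ V.card) :
    ∃ Γ : Finset (Sym2 ℕ), IsGuardSet E out F Γ ∧ Γ.card ≤ 2 * V.card / 7 := by
  obtain ⟨t, x, y, z, rfl, hE, hF, hcard⟩ := hG.exists_subdivision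
  obtain ⟨Γ, hΓE, hk, hout, hΓ⟩ := t.exists_guards (by omega) x y z
  refine ⟨Γ, ⟨hΓE.trans hE, fun f hf => ?_⟩, by omega⟩
  rcases Finset.mem_insert.1 hf with rfl | hf
  · rcases hout with h | h | h <;> exact ⟨_, h, by simp⟩
  · exact hΓ f (hF hf)

end Guarding
end

section
/- Let G be a stacked triangulation and let v be a vertex of G of degree 3 with neighbors x, y, z. Then every edge guard set Γ of G satisfies |{v,x,y,z} ∩ V(Γ)| ≥ 2. -/
namespace Guarding

lemma eq_triple_of_erase_subset {f : Finset ℕ} {v x y : ℕ} (hc : f.card = 3)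
    (h : ∀ u ∈ f, u ≠ v → u = x ∨ u = y) : f = {v, x, y} :=
  Finset.eq_of_subset_of_card_le (fun u hu => by
    have := h u hu
    simp only [Finset.mem_insert, Finset.mem_singleton]
    tauto) (hc ▸ Finset.card_le_three)

lemma exists_mem_ne_ne {f : Finset ℕ} (hc : f.card = 3) (x y : ℕ) :
    ∃ u ∈ f, u ≠ x ∧ u ≠ y := by
  by_contra! h
  have hsub : f ⊆ {x, y} := fun u hu => by
    have := h u hu
    simp only [Finset.mem_insert, Finset.mem_singleton]
    tauto
  have := (Finset.card_le_card hsub).trans Finset.card_le_two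
  omega

lemma mem_stack_edges {E : Finset (Sym2 ℕ)} {a b c n v u : ℕ} :
    s(v, u) ∈ E ∪ {s(n, a), s(n, b), s(n, c)} ↔ s(v, u) ∈ E ∨
      (v = n ∧ u ∈ ({a, b, c} : Finset ℕ)) ∨ (u = n ∧ v ∈ ({a, b, c} : Finset ℕ)) := by
  simp only [Finset.mem_union, Finset.mem_insert, Finset.mem_singleton, Sym2.eq_iff]
  tauto

lemma mem_stack_faces {F : Finset (Finset ℕ)} {a b c n : ℕ} {g : Finset ℕ}
    (hab : a ≠ b) (hbc : b ≠ c) (hac : a ≠ c) :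
    g ∈ (F.erase {a, b, c}) ∪ {{n, a, b}, {n, b, c}, {n, c, a}} ↔
      (g ≠ {a, b, c} ∧ g ∈ F) ∨ ∃ p ∈ ({a, b, c} : Finset ℕ), ∃ q ∈ ({a, b, c} : Finset ℕ),
        p ≠ q ∧ g = {n, p, q} := by
  simp only [Finset.mem_union, Finset.mem_erase, Finset.mem_insert, Finset.mem_singleton,
    exists_eq_or_imp, exists_eq_left]
  have h1 := Finset.pair_comm a b
  have h2 := Finset.pair_comm b c
  have h3 := Finset.pair_comm a c
  rw [h1, h2, h3]
  grind

lemma ne_of_card_triple {a b c : ℕ} (h : ({a, b, c} : Finset ℕ).card = 3) :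
    a ≠ b ∧ b ≠ c ∧ a ≠ c := by
  refine ⟨?_, ?_, ?_⟩ <;> rintro rfl
  · have := Finset.card_le_two (a := a) (b := c)
    simp_all
  · have := Finset.card_le_two (a := a) (b := b)
    simp_all
  · have := Finset.card_le_two (a := b) (b := a)
    simp_all

lemma IsStacked.mem_of_edge {V : Finset ℕ} {E : Finset (Sym2 ℕ)} {out : Finset ℕ}
    {F : Finset (Finset ℕ)} (hG : IsStacked V E out F) :
    (∀ f ∈ F, f ⊆ V ∧ f.card = 3 ∧ ∀ u ∈ f, ∀ w ∈ f, u ≠ w → s(u, w) ∈ E) ∧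
      ∀ u w, s(u, w) ∈ E → u ∈ V ∧ w ∈ V := by
  induction hG with
  | base x y z hxy hyz hxz =>
    refine ⟨?_, ?_⟩
    · simp only [Finset.mem_singleton, forall_eq, Finset.Subset.refl, true_and]
      refine ⟨Finset.card_eq_three.2 ⟨x, y, z, hxy, hxz, hyz, rfl⟩, ?_⟩
      simp only [Finset.mem_insert, Finset.mem_singleton, Sym2.eq_iff]
      grind
    · simp only [Finset.mem_insert, Finset.mem_singleton, Sym2.eq_iff]
      grind
  | @stack V E out F a b c n hG hf hn ih =>
    obtain ⟨ihF, ihE⟩ := ih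
    obtain ⟨hfV, hfc, hfE⟩ := ihF _ hf
    obtain ⟨hab, hbc, hac⟩ := ne_of_card_triple hfc
    simp only [mem_stack_edges, mem_stack_faces hab hbc hac]
    refine ⟨?_, ?_⟩
    · rintro g (⟨-, hg⟩ | ⟨p, hp, q, hq, hpq, rfl⟩)
      · obtain ⟨h1, h2, h3⟩ := ihF g hg
        exact ⟨h1.trans (Finset.subset_insert _ _), h2, fun u hu w hw h => .inl (h3 u hu w hw h)⟩
      · have hpV := hfV hp
        have hqV := hfV hq
        have hE := hfE p hp q hq hpq
        have hE' := hfE q hq p hp hpq.symm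
        refine ⟨?_, Finset.card_eq_three.2
          ⟨n, p, q, fun h => hn (h ▸ hpV), fun h => hn (h ▸ hqV), hpq, rfl⟩, ?_⟩
        · simp [Finset.insert_subset_iff, hpV, hqV]
        · intro u hu w hw huw
          rw [Finset.mem_insert, Finset.mem_insert, Finset.mem_singleton] at hu hw
          rcases hu with rfl | rfl | rfl <;> rcases hw with rfl | rfl | rfl <;> tauto
    · rintro u w (h | ⟨rfl, h⟩ | ⟨rfl, h⟩)
      · simp [ihE u w h]
      · exact ⟨Finset.mem_insert_self _ _, Finset.mem_insert_of_mem (hfV h)⟩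
      · exact ⟨Finset.mem_insert_of_mem (hfV h), Finset.mem_insert_self _ _⟩

lemma IsStacked.eq_out_of_degree_two {V : Finset ℕ} {E : Finset (Sym2 ℕ)} {out : Finset ℕ}
    {F : Finset (Finset ℕ)} (hG : IsStacked V E out F) {v x y : ℕ} (hv : v ∈ V)
    (hN : ∀ u, s(v, u) ∈ E ↔ u = x ∨ u = y) : out = {v, x, y} := by
  induction hG with
  | base a b c hab hbc hac =>
    refine eq_triple_of_erase_subset (Finset.card_eq_three.2 ⟨a, b, c, hab, hac, hbc, rfl⟩) ?_
    intro u hu huv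
    rw [← hN]
    simp only [Finset.mem_insert, Finset.mem_singleton, Sym2.eq_iff] at hu hv ⊢
    grind
  | @stack V E out F a b c n hG hf hn ih =>
    obtain ⟨hF, hE⟩ := hG.mem_of_edge
    obtain ⟨hfV, hfc, hfE⟩ := hF _ hf
    simp only [mem_stack_edges] at hN
    generalize ({a, b, c} : Finset ℕ) = f at *
    have hvn : v ≠ n := by
      rintro rfl
      obtain ⟨u, hu, hux, huy⟩ := exists_mem_ne_ne hfc x y
      exact ((hN u).1 (.inr (.inl ⟨rfl, hu⟩))).elim hux huy
    have hvf : v ∉ f := by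
      intro hvf
      have hfn : n ∉ f := fun h => hn (hfV h)
      rcases (hN n).1 (.inr (.inr ⟨rfl, hvf⟩)) with rfl | rfl
      · obtain ⟨u, hu, huv, huy⟩ := exists_mem_ne_ne hfc v y
        have := (hN u).1 (.inl (hfE v hvf u hu huv.symm))
        grind
      · obtain ⟨u, hu, huv, huy⟩ := exists_mem_ne_ne hfc v x
        have := (hN u).1 (.inl (hfE v hvf u hu huv.symm))
        grind
    exact ih (Finset.mem_of_mem_insert_of_ne hv hvn) fun u => by rw [← hN u]; tauto

lemma IsStacked.mem_faces_of_degree_three {V : Finset ℕ} {E : Finset (Sym2 ℕ)} {out : Finset ℕ}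
    {F : Finset (Finset ℕ)} (hG : IsStacked V E out F) {v x y z : ℕ} (hv : v ∈ V)
    (hxy : x ≠ y) (hyz : y ≠ z) (hxz : x ≠ z)
    (hN : ∀ u, s(v, u) ∈ E ↔ u = x ∨ u = y ∨ u = z) : {v, x, y} ∈ faces out F := by
  induction hG with
  | base a b c hab hbc hac =>
    have hx := (hN x).2 (by tauto)
    have hy := (hN y).2 (by tauto)
    have hz := (hN z).2 (by tauto)
    simp only [Finset.mem_insert, Finset.mem_singleton, Sym2.eq_iff] at hx hy hz
    grind
  | @stack V E out F a b c n hG hf hn ih =>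
    obtain ⟨hF, hE⟩ := hG.mem_of_edge
    obtain ⟨hfV, hfc, hfE⟩ := hF _ hf
    obtain ⟨hab, hbc, hac⟩ := ne_of_card_triple hfc
    simp only [faces, Finset.mem_insert (s := _ ∪ _), mem_stack_edges,
      mem_stack_faces hab hbc hac] at hN ih ⊢
    generalize ({a, b, c} : Finset ℕ) = f at *
    have hfn : n ∉ f := fun h => hn (hfV h)
    have hnE : ∀ w, s(n, w) ∉ E := fun w h => hn (hE _ _ h).1
    have hnE' : ∀ w, s(w, n) ∉ E := fun w h => hn (hE _ _ h).2
    rcases eq_or_ne v n with rfl | hvn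
    · have hx : x ∈ f := by have := (hN x).2 (by tauto); grind
      have hy : y ∈ f := by have := (hN y).2 (by tauto); grind
      exact .inr (.inr ⟨x, hx, y, hy, hxy, rfl⟩)
    have hvV := Finset.mem_of_mem_insert_of_ne hv hvn
    by_cases hvf : v ∈ f
    · have hfN : ∀ u ∈ f, u ≠ v → u = x ∨ u = y ∨ u = z := fun u hu huv =>
        (hN u).1 (.inl (hfE v hvf u hu huv.symm))
      rcases (hN n).1 (.inr (.inr ⟨rfl, hvf⟩)) with rfl | rfl | rfl
      · have hfe : f = {v, y, z} := eq_triple_of_erase_subset hfc (by grind)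
        exact .inr (.inr ⟨v, hvf, y, by simp [hfe], by grind, Finset.insert_comm _ _ _⟩)
      · have hfe : f = {v, x, z} := eq_triple_of_erase_subset hfc (by grind)
        refine .inr (.inr ⟨v, hvf, x, by simp [hfe], by grind, ?_⟩)
        rw [Finset.pair_comm, Finset.insert_comm]
      · left
        refine (hG.eq_out_of_degree_two hvV fun u => ?_).symm
        have := hN u
        grind
    · have := ih hvV fun u => by rw [← hN u]; tauto
      rcases Finset.mem_insert.1 this with h | h
      · exact .inl h
      · exact .inr (.inl ⟨fun e => hvf (e ▸ Finset.mem_insert_self _ _), h⟩)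

lemma IsStacked.not_loop {V : Finset ℕ} {E : Finset (Sym2 ℕ)} {out : Finset ℕ}
    {F : Finset (Finset ℕ)} (hG : IsStacked V E out F) (v : ℕ) : s(v, v) ∉ E := by
  induction hG with
  | base x y z hxy hyz hxz =>
    simp only [Finset.mem_insert, Finset.mem_singleton, Sym2.eq_iff]
    grind
  | stack a b c n hG hf hn ih =>
    have := (hG.mem_of_edge.1 _ hf).1
    rw [mem_stack_edges]
    grind

/-- If `v` is a vertex of a stacked triangulation of degree `3` with neighbors `x, y, z`,
then every edge guard set `Γ` satisfies `|{v,x,y,z} ∩ V(Γ)| ≥ 2`. -/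
theorem degree_three_guards (V : Finset ℕ) (E : Finset (Sym2 ℕ)) (out : Finset ℕ)
    (F : Finset (Finset ℕ)) (x y z v : ℕ)
    (hG : IsStacked V E out F)
    (hv : v ∈ V) (hxy : x ≠ y) (hyz : y ≠ z) (hxz : x ≠ z)
    (hnbr : ∀ u : ℕ, s(v, u) ∈ E ↔ u ∈ ({x, y, z} : Finset ℕ))
    (Γ : Finset (Sym2 ℕ)) (hΓ : IsGuardSet E out F Γ) :
    2 ≤ (({v, x, y, z} : Set ℕ) ∩ gv Γ).ncard := by
  have hN : ∀ u, s(v, u) ∈ E ↔ u = x ∨ u = y ∨ u = z := by simpa using hnbr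
  have hxyF := hG.mem_faces_of_degree_three hv hxy hyz hxz hN
  have hyzF := hG.mem_faces_of_degree_three hv hyz hxz.symm hxy.symm (fun u => by rw [hN]; tauto)
  have hxzF := hG.mem_faces_of_degree_three hv hxz hyz.symm hxy (fun u => by rw [hN]; tauto)
  have hvE : s(v, v) ∉ E := hG.not_loop v
  have hfin : (({v, x, y, z} : Set ℕ) ∩ gv Γ).Finite := (Set.toFinite _).inter_of_left _
  suffices ∃ p q, p ∈ ({v, x, y, z} : Set ℕ) ∩ gv Γ ∧ q ∈ ({v, x, y, z} : Set ℕ) ∩ gv Γ ∧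
      p ≠ q by
    obtain ⟨p, q, hp, hq, hpq⟩ := this
    exact (Set.one_lt_ncard hfin).2 ⟨p, hp, q, hq, hpq⟩
  by_cases hvΓ : v ∈ gv Γ
  · obtain ⟨e, he, hve⟩ := hvΓ
    obtain ⟨u, rfl⟩ := Sym2.mem_iff_exists.1 hve
    have hu := (hN u).1 (hΓ.1 he)
    refine ⟨v, u, ⟨by simp, _, he, hve⟩, ⟨by simp [hu], _, he, Sym2.mem_mk_right _ _⟩, ?_⟩
    rintro rfl
    exact hvE (hΓ.1 he)
  · obtain ⟨p, hp, hpf⟩ := hΓ.2 _ hxyF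
    obtain ⟨q, hq, hqf⟩ := hΓ.2 _ hyzF
    obtain ⟨r, hr, hrf⟩ := hΓ.2 _ hxzF
    simp only [Finset.mem_insert, Finset.mem_singleton] at hpf hqf hrf
    simp only [Set.mem_inter_iff, Set.mem_insert_iff, Set.mem_singleton_iff]
    grind

end Guarding
end

section
/- Let G be a stacked triangulation on exactly 6 vertices with outer face {x,y,z}, and let u ∈ {x,y,z}. Then there exists an edge ab of G with a ∈ {x,y,z} \ {u} such that every face of G that does not contain u contains a or b. -/
namespace Guarding

section

variable {V : Finset ℕ} {E : Finset (Sym2 ℕ)} {out : Finset ℕ} {F : Finset (Finset ℕ)}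

theorem IsStacked.face_subset_and_card (h : IsStacked V E out F) :
    ∀ f ∈ F, f ⊆ V ∧ f.card = 3 := by
  induction h with
  | base x y z hxy hyz hxz =>
    intro f hf
    obtain rfl := Finset.mem_singleton.1 hf
    exact ⟨subset_rfl, Finset.card_eq_three.2 ⟨x, y, z, hxy, hxz, hyz, rfl⟩⟩
  | @stack V E out F x y z v hG hf hv ih =>
    obtain ⟨hs, hc⟩ := ih _ hf
    obtain ⟨hx, hy, hz⟩ : x ∈ V ∧ y ∈ V ∧ z ∈ V := by
      simpa [Finset.insert_subset_iff] using hs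
    have hne : x ≠ y ∧ y ≠ z ∧ z ≠ x := by
      refine ⟨?_, ?_, ?_⟩ <;> rintro rfl
      · have := Finset.card_le_two (a := x) (b := z)
        simp at hc; omega
      · have := Finset.card_le_two (a := x) (b := y)
        simp at hc; omega
      · have := Finset.card_le_two (a := y) (b := z)
        simp [Finset.insert_comm z y] at hc; omega
    have hvne : ∀ w ∈ V, v ≠ w := fun w hw hvw => hv (hvw ▸ hw)
    intro f hf'
    simp only [Finset.mem_union, Finset.mem_erase, Finset.mem_insert,
      Finset.mem_singleton] at hf'
    rcases hf' with ⟨-, hf'⟩ | rfl | rfl | rfl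
    · exact ⟨(ih f hf').1.trans (Finset.subset_insert _ _), (ih f hf').2⟩
    · exact ⟨by simp [Finset.insert_subset_iff, hx, hy],
        Finset.card_eq_three.2 ⟨_, _, _, hvne x hx, hvne y hy, hne.1, rfl⟩⟩
    · exact ⟨by simp [Finset.insert_subset_iff, hy, hz],
        Finset.card_eq_three.2 ⟨_, _, _, hvne y hy, hvne z hz, hne.2.1, rfl⟩⟩
    · exact ⟨by simp [Finset.insert_subset_iff, hz, hx],
        Finset.card_eq_three.2 ⟨_, _, _, hvne z hz, hvne x hx, hne.2.2, rfl⟩⟩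

theorem IsStacked.three_le_card (h : IsStacked V E out F) : 3 ≤ V.card := by
  induction h with
  | base x y z hxy hyz hxz => exact (Finset.card_eq_three.2 ⟨x, y, z, hxy, hxz, hyz, rfl⟩).ge
  | stack x y z v hG hf hv ih => rw [Finset.card_insert_of_notMem hv]; omega

theorem IsStacked.of_card_eq_three (h : IsStacked V E out F) (hV : V.card = 3) :
    V = out ∧ F = {out} := by
  cases h with
  | base x y z hxy hyz hxz => exact ⟨rfl, rfl⟩
  | stack x y z v hG hf hv =>
    have := hG.three_le_card
    rw [Finset.card_insert_of_notMem hv] at hV; omega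

/-- A stacked triangulation on more than three vertices arises by stacking a vertex `v`
into an inner face `t` of a smaller one. -/
theorem IsStacked.exists_stack {n : ℕ} (h : IsStacked V E out F) (hV : V.card = n + 1)
    (hn : 3 ≤ n) :
    ∃ V' E' F' t v, IsStacked V' E' out F' ∧ V'.card = n ∧ t ∈ F' ∧ v ∉ V' ∧
      V = insert v V' ∧ E' ⊆ E ∧ (∀ w ∈ t, s(v, w) ∈ E) ∧
      ∀ f ∈ F, f ∈ F' ∨ (v ∈ f ∧ f ⊆ insert v t) := by
  cases h with
  | base x y z hxy hyz hxz =>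
    have := Finset.card_eq_three.2 ⟨x, y, z, hxy, hxz, hyz, rfl⟩
    omega
  | stack x y z v hG hf hv =>
    refine ⟨_, _, _, _, v, hG, ?_, hf, hv, rfl, Finset.subset_union_left, ?_, ?_⟩
    · rw [Finset.card_insert_of_notMem hv] at hV; omega
    · simp
    · intro f hf'
      simp only [Finset.mem_union, Finset.mem_erase, Finset.mem_insert,
        Finset.mem_singleton] at hf'
      rcases hf' with ⟨-, hf'⟩ | rfl | rfl | rfl
      · exact .inl hf'
      all_goals exact .inr ⟨by simp, by simp [Finset.insert_subset_iff]⟩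

theorem exists_guard_avoiding {u a c : ℕ} (hua : u ≠ a) (huc : u ≠ c) (hac : a ≠ c)
    (hG : IsStacked V E {u, a, c} F) (hn : V.card = 6) :
    ∃ a' b : ℕ, s(a', b) ∈ E ∧ a' ∈ ({u, a, c} : Finset ℕ) ∧ a' ≠ u ∧
      ∀ f ∈ faces {u, a, c} F, u ∉ f → (a' ∈ f ∨ b ∈ f) := by
  obtain ⟨V₅, E₅, F₅, t₅, r, hG₅, hn₅, ht₅, hr, rfl, hE₅, -, hF₅⟩ := hG.exists_stack hn (by simp)
  obtain ⟨V₄, E₄, F₄, t₄, q, hG₄, hn₄, ht₄, hq, rfl, hE₄, hq_adj, hF₄⟩ :=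
    hG₅.exists_stack hn₅ (by simp)
  obtain ⟨V₃, E₃, F₃, t₃, p, hG₃, hn₃, ht₃, hp, rfl, hE₃, hp_adj, hF₃⟩ :=
    hG₄.exists_stack hn₄ le_rfl
  obtain ⟨rfl, rfl⟩ := hG₃.of_card_eq_three hn₃
  obtain rfl := Finset.mem_singleton.1 ht₃
  have hrV := hr
  have hqV := hq
  simp only [Finset.mem_insert, Finset.mem_singleton, not_or] at hr hq hp
  obtain ⟨hrq, hrp, hru, hra, hrc⟩ := hr
  obtain ⟨hqp, hqu, hqa, hqc⟩ := hq
  obtain ⟨hpu, hpa, hpc⟩ := hp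
  have eq_of_subset : ∀ f ∈ F, ∀ i j k, f ⊆ {i, j, k} → f = {i, j, k} :=
    fun f hf i j k hs => Finset.eq_of_subset_of_card_le hs
      (Finset.card_le_three.trans (hG.face_subset_and_card f hf).2.ge)
  have mem_V : ∀ f ∈ F, ∀ w ∈ f, w = r ∨ w = q ∨ w = p ∨ w = u ∨ w = a ∨ w = c :=
    fun f hf w hw => by simpa using (hG.face_subset_and_card f hf).1 hw
  have mem_t₅ : ∀ f ∈ F, r ∈ f → ∀ w ∈ f, w ≠ r → w ∈ t₅ := by
    intro f hf hrf w hw hwr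
    rcases hF₅ f hf with h | ⟨-, h⟩
    · exact absurd ((hG₅.face_subset_and_card f h).1 hrf) hrV
    · exact (Finset.mem_insert.1 (h hw)).resolve_left hwr
  suffices ∃ a' b : ℕ, s(a', b) ∈ E ∧ a' ∈ ({u, a, c} : Finset ℕ) ∧ a' ≠ u ∧
      ∀ f ∈ F, u ∉ f → (a' ∈ f ∨ b ∈ f) by
    obtain ⟨a', b, hab, ha', hne, h⟩ := this
    exact ⟨a', b, hab, ha', hne, Finset.forall_mem_insert _ _ _ |>.2 ⟨by simp, h⟩⟩
  have pa : s(a, p) ∈ E := by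
    rw [Sym2.eq_swap]; exact hE₅ (hE₄ (hp_adj a (by simp)))
  have pc : s(c, p) ∈ E := by
    rw [Sym2.eq_swap]; exact hE₅ (hE₄ (hp_adj c (by simp)))
  by_cases h1 : ∀ f ∈ F, u ∉ f → a ∈ f ∨ p ∈ f
  · exact ⟨a, p, pa, by simp, hua.symm, h1⟩
  by_cases h2 : ∀ f ∈ F, u ∉ f → c ∈ f ∨ p ∈ f
  · exact ⟨c, p, pc, by simp, huc.symm, h2⟩
  push Not at h1 h2
  obtain ⟨f, hf, huf, haf, hpf⟩ := h1
  obtain ⟨g, hg, hug, hcg, hpg⟩ := h2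
  have hf_eq : f = {c, q, r} := eq_of_subset f hf _ _ _ fun w hw => by
    rcases mem_V f hf w hw with rfl | rfl | rfl | rfl | rfl | rfl <;>
      first | exact absurd hw (by assumption) | simp
  have hg_eq : g = {a, q, r} := eq_of_subset g hg _ _ _ fun w hw => by
    rcases mem_V g hg w hw with rfl | rfl | rfl | rfl | rfl | rfl <;>
      first | exact absurd hw (by assumption) | simp
  have hct : c ∈ t₅ := mem_t₅ f hf (by simp [hf_eq]) c (by simp [hf_eq]) (Ne.symm hrc)
  have hqt : q ∈ t₅ := mem_t₅ f hf (by simp [hf_eq]) q (by simp [hf_eq]) (Ne.symm hrq)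
  have hat : a ∈ t₅ := mem_t₅ g hg (by simp [hg_eq]) a (by simp [hg_eq]) (Ne.symm hra)
  have ht₅_eq : {a, c, q} = t₅ := Finset.eq_of_subset_of_card_le
    (by simp [Finset.insert_subset_iff, hct, hqt, hat])
    ((hG₅.face_subset_and_card _ ht₅).2.trans
      (Finset.card_eq_three.2 ⟨a, c, q, hac, Ne.symm hqa, Ne.symm hqc, rfl⟩).symm).le
  have hat₄ : a ∈ t₄ := by
    rcases hF₄ _ ht₅ with h | ⟨-, h⟩
    · exact absurd ((hG₄.face_subset_and_card _ h).1 hqt) hqV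
    · exact (Finset.mem_insert.1 (h hat)).resolve_left (Ne.symm hqa)
  have qa : s(a, q) ∈ E := by
    rw [Sym2.eq_swap]; exact hE₅ (hq_adj a hat₄)
  refine ⟨a, q, qa, by simp, hua.symm, fun k hk huk => ?_⟩
  by_contra! hk'
  obtain ⟨hak, hqk⟩ := hk'
  have hk_eq : k = {c, p, r} := eq_of_subset k hk _ _ _ fun w hw => by
    rcases mem_V k hk w hw with rfl | rfl | rfl | rfl | rfl | rfl <;>
      first | exact absurd hw (by assumption) | simp
  have hpt : p ∈ t₅ := mem_t₅ k hk (by simp [hk_eq]) p (by simp [hk_eq]) (Ne.symm hrp)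
  simp only [← ht₅_eq, Finset.mem_insert, Finset.mem_singleton] at hpt
  rcases hpt with h | h | h
  exacts [hpa h, hpc h, hqp h.symm]

end

/-- Let `G` be a stacked triangulation on exactly `6` vertices with outer face `{x,y,z}`
and let `u ∈ {x,y,z}`. Then there is an edge `ab` of `G` with `a ∈ {x,y,z} \ {u}` such that
every face of `G` not containing `u` contains `a` or `b`. -/
theorem six_vertex_guard_avoiding (V : Finset ℕ) (E : Finset (Sym2 ℕ))
    (F : Finset (Finset ℕ)) (x y z u : ℕ)
    (hxy : x ≠ y) (hyz : y ≠ z) (hxz : x ≠ z)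
    (hG : IsStacked V E {x, y, z} F) (hn : V.card = 6)
    (hu : u ∈ ({x, y, z} : Finset ℕ)) :
    ∃ a b : ℕ, s(a, b) ∈ E ∧ a ∈ ({x, y, z} : Finset ℕ) ∧ a ≠ u ∧
      ∀ f ∈ faces {x, y, z} F, u ∉ f → (a ∈ f ∨ b ∈ f) := by
  simp only [Finset.mem_insert, Finset.mem_singleton] at hu
  rcases hu with rfl | rfl | rfl
  · exact exists_guard_avoiding hxy hxz hyz hG hn
  · rw [Finset.insert_comm] at hG ⊢
    exact exists_guard_avoiding hxy.symm hyz hxz hG hn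
  · have hrot : ({x, y, u} : Finset ℕ) = {u, x, y} := by
      ext; simp; tauto
    rw [hrot] at hG ⊢
    exact exists_guard_avoiding hxz.symm hyz.symm hxy hG hn

end Guarding
end

section
/- Let G₀ be a stacked triangulation with an inner face f = {x,y,z}, and let G be the stacked triangulation obtained from G₀ by first stacking a new vertex a into f (adding edges ax, ay, az) and then stacking a new vertex b into the face {a,x,y} (adding edges ab, bx, by). Then for every edge guard set Γ of G there exists an edge guard set Γ' of G with |Γ'| ≤ |Γ| and {x,y} ⊆ V(Γ'). -/
namespace Guarding

/-- The boundary vertices of an inner face are three pairwise adjacent vertices of the graph,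
the outer face consists of vertices, and edges join vertices. -/
lemma IsStacked.wellFormed {V : Finset ℕ} {E : Finset (Sym2 ℕ)} {out : Finset ℕ}
    {F : Finset (Finset ℕ)} (h : IsStacked V E out F) :
    (∀ f ∈ F, f ⊆ V ∧ f.card = 3 ∧ ∀ u ∈ f, ∀ w ∈ f, u ≠ w → s(u, w) ∈ E) ∧
      out ⊆ V ∧ ∀ e ∈ E, ∀ u ∈ e, u ∈ V := by
  induction h with
  | base x y z hxy hyz hxz =>
    refine ⟨?_, subset_rfl, ?_⟩
    · intro f hf
      obtain rfl := Finset.mem_singleton.1 hf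
      refine ⟨subset_rfl, Finset.card_eq_three.2 ⟨x, y, z, hxy, hxz, hyz, rfl⟩, ?_⟩
      intro u hu w hw huw
      simp only [Finset.mem_insert, Finset.mem_singleton, Sym2.eq_iff] at *
      grind
    · intro e he u hu
      simp only [Finset.mem_insert, Finset.mem_singleton] at *
      rcases he with rfl | rfl | rfl <;> simp only [Sym2.mem_iff] at hu <;> tauto
  | @stack V E out F x y z v hG hf hv ih =>
    obtain ⟨hface, hout, hedge⟩ := ih
    obtain ⟨hsub, hcard, hadj⟩ := hface _ hf
    have hx : x ∈ V := hsub (by simp)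
    have hy : y ∈ V := hsub (by simp)
    have hz : z ∈ V := hsub (by simp)
    obtain ⟨hxy, hxz, hyz⟩ := Finset.card_triple_eq_three_iff.1 hcard
    have new_face : ∀ p ∈ ({x, y, z} : Finset ℕ), ∀ q ∈ ({x, y, z} : Finset ℕ), p ≠ q →
        ({v, p, q} : Finset ℕ) ⊆ insert v V ∧ ({v, p, q} : Finset ℕ).card = 3 ∧
        ∀ u ∈ ({v, p, q} : Finset ℕ), ∀ w ∈ ({v, p, q} : Finset ℕ), u ≠ w →
          s(u, w) ∈ E ∪ {s(v, x), s(v, y), s(v, z)} := by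
      intro p hp q hq hpq
      have hpV := hsub hp
      have hqV := hsub hq
      have hE := hadj p hp q hq hpq
      have hE' := hadj q hq p hp hpq.symm
      refine ⟨?_, Finset.card_eq_three.2 ⟨v, p, q, ?_, ?_, hpq, rfl⟩, ?_⟩
      · intro u hu
        simp only [Finset.mem_insert, Finset.mem_singleton] at *
        grind
      · rintro rfl; exact hv hpV
      · rintro rfl; exact hv hqV
      · intro u hu w hw huw
        simp only [Finset.mem_insert, Finset.mem_singleton, Finset.mem_union, Sym2.eq_iff] at *
        grind
    refine ⟨?_, hout.trans (Finset.subset_insert _ _), ?_⟩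
    · intro f hfF
      simp only [Finset.mem_union, Finset.mem_erase, Finset.mem_insert,
        Finset.mem_singleton] at hfF
      rcases hfF with ⟨-, hfF⟩ | rfl | rfl | rfl
      · obtain ⟨h₁, h₂, h₃⟩ := hface f hfF
        exact ⟨h₁.trans (Finset.subset_insert _ _), h₂, fun u hu w hw huw =>
          Finset.mem_union_left _ (h₃ u hu w hw huw)⟩
      · exact new_face x (by simp) y (by simp) hxy
      · exact new_face y (by simp) z (by simp) hyz
      · exact new_face z (by simp) x (by simp) hxz.symm
    · intro e he u hu
      simp only [Finset.mem_union, Finset.mem_insert, Finset.mem_singleton] at he ⊢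
      rcases he with he | rfl | rfl | rfl
      · exact Or.inr (hedge e he u hu)
      all_goals
        rcases Sym2.mem_iff.1 hu with rfl | rfl <;> tauto

/-- Exchanging an edge `e` of a guard set for an edge `e'` keeps it a guard set covering `x` and
`y`, provided `x` and `y` are covered afterwards and every face avoiding `x` and `y` also avoids
the endpoints of `e` that are not endpoints of `e'`. -/
lemma IsGuardSet.exchange {E : Finset (Sym2 ℕ)} {out : Finset ℕ} {F : Finset (Finset ℕ)}
    {Γ : Finset (Sym2 ℕ)} (hΓ : IsGuardSet E out F Γ) {e e' : Sym2 ℕ} {x y : ℕ}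
    (he : e ∈ Γ) (he' : e' ∈ E)
    (hx : x ∈ gv (insert e' (Γ.erase e))) (hy : y ∈ gv (insert e' (Γ.erase e)))
    (hfaces : ∀ f ∈ faces out F, x ∉ f → y ∉ f → ∀ u ∈ e, u ∈ f → u ∈ e') :
    ∃ Γ' : Finset (Sym2 ℕ), IsGuardSet E out F Γ' ∧ Γ'.card ≤ Γ.card ∧
      x ∈ gv Γ' ∧ y ∈ gv Γ' := by
  refine ⟨insert e' (Γ.erase e), ⟨?_, ?_⟩, ?_, hx, hy⟩
  · exact Finset.insert_subset he' ((Finset.erase_subset _ _).trans hΓ.1)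
  · intro f hf
    by_cases hxf : x ∈ f
    · exact ⟨x, hx, hxf⟩
    by_cases hyf : y ∈ f
    · exact ⟨y, hy, hyf⟩
    obtain ⟨u, ⟨d, hd, hud⟩, huf⟩ := hΓ.2 f hf
    refine ⟨u, ?_, huf⟩
    by_cases hde : d = e
    · subst hde
      exact ⟨e', Finset.mem_insert_self _ _, hfaces f hf hxf hyf u hud huf⟩
    · exact ⟨d, Finset.mem_insert_of_mem (Finset.mem_erase.2 ⟨hde, hd⟩), hud⟩
  · calc (insert e' (Γ.erase e)).card ≤ (Γ.erase e).card + 1 := Finset.card_insert_le _ _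
      _ = Γ.card := Finset.card_erase_add_one he

lemma mem_gv_insert_self {Γ : Finset (Sym2 ℕ)} {e : Sym2 ℕ} {u : ℕ} (hu : u ∈ e) :
    u ∈ gv (insert e Γ) :=
  ⟨e, Finset.mem_insert_self _ _, hu⟩

lemma mem_gv_insert_erase {Γ : Finset (Sym2 ℕ)} {e e' : Sym2 ℕ} {u : ℕ} (hu : u ∈ gv Γ)
    (hue : u ∉ e) : u ∈ gv (insert e' (Γ.erase e)) := by
  obtain ⟨d, hd, hud⟩ := hu
  refine ⟨d, Finset.mem_insert_of_mem (Finset.mem_erase.2 ⟨?_, hd⟩), hud⟩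
  rintro rfl
  exact hue hud

/-- Weak forcing lemma: let `G₀` be a stacked triangulation with inner face `{x,y,z}`,
and let `G` be obtained from `G₀` by stacking `a` into `{x,y,z}` and then stacking `b`
into the face `{a,x,y}`. Then every edge guard set `Γ` of `G` can be replaced by an
edge guard set `Γ'` of `G` with `|Γ'| ≤ |Γ|` and `{x,y} ⊆ V(Γ')`. -/
theorem weak_forcing (V : Finset ℕ) (E : Finset (Sym2 ℕ)) (out : Finset ℕ)
    (F : Finset (Finset ℕ)) (x y z a b : ℕ)
    (hG0 : IsStacked V E out F) (hf : ({x, y, z} : Finset ℕ) ∈ F)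
    (ha : a ∉ V) (hb : b ∉ insert a V)
    (E' : Finset (Sym2 ℕ)) (F' : Finset (Finset ℕ))
    (hE' : E' = (E ∪ {s(a, x), s(a, y), s(a, z)}) ∪ {s(b, a), s(b, x), s(b, y)})
    (hF' : F' = (((F.erase {x, y, z}) ∪ {{a, x, y}, {a, y, z}, {a, z, x}}).erase {a, x, y})
        ∪ {{b, a, x}, {b, x, y}, {b, y, a}})
    (Γ : Finset (Sym2 ℕ)) (hΓ : IsGuardSet E' out F' Γ) :
    ∃ Γ' : Finset (Sym2 ℕ), IsGuardSet E' out F' Γ' ∧ Γ'.card ≤ Γ.card ∧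
      x ∈ gv Γ' ∧ y ∈ gv Γ' := by
  obtain ⟨hface, hout, hedge⟩ := hG0.wellFormed
  obtain ⟨hsub, hcard, hadj⟩ := hface _ hf
  obtain ⟨hxy, hxz, hyz⟩ := Finset.card_triple_eq_three_iff.1 hcard
  have hxV : x ∈ V := hsub (by simp)
  have hyV : y ∈ V := hsub (by simp)
  have hzV : z ∈ V := hsub (by simp)
  have hbV : b ∉ V := fun h => hb (Finset.mem_insert_of_mem h)
  have hba : b ≠ a := fun h => hb (h ▸ Finset.mem_insert_self _ _)
  have hEE' : ∀ u ∈ ({x, y, z} : Finset ℕ), ∀ w ∈ ({x, y, z} : Finset ℕ), u ≠ w →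
      s(u, w) ∈ E' := by
    intro u hu w hw huw
    rw [hE']
    exact Finset.mem_union_left _ (Finset.mem_union_left _ (hadj u hu w hw huw))
  have hxyE : s(x, y) ∈ E' := hEE' x (by simp) y (by simp) hxy
  have hxzE : s(x, z) ∈ E' := hEE' x (by simp) z (by simp) hxz
  have hyzE : s(y, z) ∈ E' := hEE' y (by simp) z (by simp) hyz
  have old_face : ∀ f ∈ faces out F', x ∉ f → y ∉ f → f ⊆ V := by
    intro f hfF hxf hyf
    simp only [faces, hF', Finset.mem_insert, Finset.mem_union, Finset.mem_erase,
      Finset.mem_singleton] at hfF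
    rcases hfF with rfl | ⟨-, ⟨-, hfF⟩ | rfl | rfl | rfl⟩ | rfl | rfl | rfl
    · exact hout
    · exact (hface f hfF).1
    all_goals simp at hxf hyf
  have exchange : ∀ e ∈ Γ, ∀ e' ∈ E', (∀ u ∈ e, u = a ∨ u = b ∨ u = x ∨ u = y ∨ u ∈ e') →
      x ∈ gv (insert e' (Γ.erase e)) → y ∈ gv (insert e' (Γ.erase e)) →
      ∃ Γ' : Finset (Sym2 ℕ), IsGuardSet E' out F' Γ' ∧ Γ'.card ≤ Γ.card ∧
        x ∈ gv Γ' ∧ y ∈ gv Γ' := by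
    intro e he e' he' hee' hx hy
    refine hΓ.exchange he he' hx hy fun f hfF hxf hyf u hue huf => ?_
    have huV := old_face f hfF hxf hyf huf
    rcases hee' u hue with rfl | rfl | rfl | rfl | h
    exacts [absurd huV ha, absurd huV hbV, absurd huf hxf, absurd huf hyf, h]
  have exchange_xy : ∀ e ∈ Γ, (∀ u ∈ e, u = a ∨ u = b ∨ u = x ∨ u = y) →
      ∃ Γ' : Finset (Sym2 ℕ), IsGuardSet E' out F' Γ' ∧ Γ'.card ≤ Γ.card ∧
        x ∈ gv Γ' ∧ y ∈ gv Γ' := fun e he hee =>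
    exchange e he s(x, y) hxyE (fun u hu => by have := hee u hu; tauto)
      (mem_gv_insert_self (by simp)) (mem_gv_insert_self (by simp))
  by_cases hbΓ : b ∈ gv Γ
  · obtain ⟨e, he, hbe⟩ := hbΓ
    refine exchange_xy e he ?_
    have heE := hΓ.1 he
    simp only [hE', Finset.mem_union, Finset.mem_insert, Finset.mem_singleton] at heE
    rcases heE with (heE | rfl | rfl | rfl) | rfl | rfl | rfl
    · exact absurd (hedge e heE b hbe) hbV
    all_goals
      simp only [Sym2.mem_iff] at hbe ⊢
      grind
  have hmem : ∀ p q, ({b, p, q} : Finset ℕ) ∈ F' → p ∈ gv Γ ∨ q ∈ gv Γ := by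
    intro p q hpq
    obtain ⟨u, hu, huf⟩ := hΓ.2 _ (Finset.mem_insert_of_mem hpq)
    simp only [Finset.mem_insert, Finset.mem_singleton] at huf
    rcases huf with rfl | rfl | rfl
    exacts [absurd hu hbΓ, Or.inl hu, Or.inr hu]
  have hax := hmem a x (by simp [hF'])
  have hxy' := hmem x y (by simp [hF'])
  have hya := hmem y a (by simp [hF'])
  by_cases hboth : x ∈ gv Γ ∧ y ∈ gv Γ
  · exact ⟨Γ, hΓ, le_rfl, hboth⟩
  have haΓ : a ∈ gv Γ := by tauto
  obtain ⟨e, he, hae⟩ := haΓ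
  have heE := hΓ.1 he
  simp only [hE', Finset.mem_union, Finset.mem_insert, Finset.mem_singleton] at heE
  rcases heE with (heE | rfl | rfl | rfl) | rfl | rfl | rfl
  · exact absurd (hedge e heE a hae) ha
  · exact exchange_xy _ he (by simp)
  · exact exchange_xy _ he (by simp)
  · have hxe : x ∉ s(a, z) := by
      rw [Sym2.mem_iff]; grind
    have hye : y ∉ s(a, z) := by
      rw [Sym2.mem_iff]; grind
    rcases hxy' with hx | hy
    · exact exchange _ he s(y, z) hyzE (by simp) (mem_gv_insert_erase hx hxe)
        (mem_gv_insert_self (by simp))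
    · exact exchange _ he s(x, z) hxzE (by simp) (mem_gv_insert_self (by simp))
        (mem_gv_insert_erase hy hye)
  all_goals exact absurd ⟨_, he, by simp⟩ hbΓ

end Guarding
end

section
/- Let G be a stacked triangulation on exactly 8 vertices with outer face {x,y,z}, let v be the unique vertex of G adjacent to all of x, y, z, and suppose that the sub-triangulation of G inside {v,x,y} has 6 vertices, that {v,y,z} is a face of G, and that the sub-triangulation of G inside {v,z,x} has 4 vertices. Let G₀ be the 4-vertex stacked triangulation on vertex set {v,x,y,z} with outer face {x,y,z} and faces {x,y,z}, {v,x,y}, {v,y,z}, {v,z,x}. Then for every edge guard set Γ' of G₀ there exists an edge e of G such that Γ' ∪ {e} is an edge guard set of G. -/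
namespace Guarding

theorem ne_of_card_eq_three_s9 {a b c : ℕ} (h : ({a, b, c} : Finset ℕ).card = 3) :
    a ≠ b ∧ a ≠ c ∧ b ≠ c := by
  refine ⟨?_, ?_, ?_⟩ <;> rintro rfl
  · have := Finset.card_le_two (a := a) (b := c)
    rw [Finset.insert_idem] at h
    omega
  · have := Finset.card_le_two (a := a) (b := b)
    rw [Finset.pair_comm b a, Finset.insert_idem] at h
    omega
  · have := Finset.card_le_two (a := a) (b := b)
    rw [Finset.pair_eq_singleton] at h
    omega

namespace IsStacked

variable {V : Finset ℕ} {E : Finset (Sym2 ℕ)} {out : Finset ℕ} {F : Finset (Finset ℕ)}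

theorem face_subset (h : IsStacked V E out F) : ∀ f ∈ F, f ⊆ V := by
  induction h with
  | base => simp
  | stack x y z v hG hf hv ih =>
    have h0 := ih _ hf
    intro f hfm
    simp only [Finset.mem_union, Finset.mem_erase, Finset.mem_insert,
      Finset.mem_singleton] at hfm
    have hx : x ∈ _ := h0 (by simp)
    have hy : y ∈ _ := h0 (by simp)
    have hz : z ∈ _ := h0 (by simp)
    rcases hfm with h | rfl | rfl | rfl
    · exact (ih f h.2).trans (Finset.subset_insert _ _)
    all_goals
      intro u hu
      simp only [Finset.mem_insert, Finset.mem_singleton] at hu ⊢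
      rcases hu with rfl | rfl | rfl <;> simp [*]

theorem face_card (h : IsStacked V E out F) : ∀ f ∈ F, f.card = 3 := by
  induction h with
  | base x y z hxy hyz hxz => simpa using Finset.card_eq_three.2 ⟨x, y, z, hxy, hxz, hyz, rfl⟩
  | stack x y z v hG hf hv ih =>
    have h0 := hG.face_subset _ hf
    have hvx : v ≠ x := fun e => hv (h0 (by simp [e]))
    have hvy : v ≠ y := fun e => hv (h0 (by simp [e]))
    have hvz : v ≠ z := fun e => hv (h0 (by simp [e]))
    obtain ⟨hxy, hxz, hyz⟩ := ne_of_card_eq_three_s9 (ih _ hf)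
    intro f hfm
    simp only [Finset.mem_union, Finset.mem_erase, Finset.mem_insert,
      Finset.mem_singleton] at hfm
    rcases hfm with h | rfl | rfl | rfl
    · exact ih f h.2
    · exact Finset.card_eq_three.2 ⟨_, _, _, hvx, hvy, hxy, rfl⟩
    · exact Finset.card_eq_three.2 ⟨_, _, _, hvy, hvz, hyz, rfl⟩
    · exact Finset.card_eq_three.2 ⟨_, _, _, hvz, hvx, hxz.symm, rfl⟩

theorem out_subset_s9 (h : IsStacked V E out F) : out ⊆ V := by
  induction h with
  | base => rfl
  | stack x y z v hG hf hv ih => exact ih.trans (Finset.subset_insert _ _)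

theorem out_card (h : IsStacked V E out F) : out.card = 3 := by
  induction h with
  | base x y z hxy hyz hxz => exact Finset.card_eq_three.2 ⟨x, y, z, hxy, hxz, hyz, rfl⟩
  | stack x y z v hG hf hv ih => exact ih

theorem out_edge (h : IsStacked V E out F) :
    ∀ u ∈ out, ∀ w ∈ out, u ≠ w → s(u, w) ∈ E := by
  induction h with
  | base x y z hxy hyz hxz =>
    intro u hu w hw huw
    simp only [Finset.mem_insert, Finset.mem_singleton] at hu hw
    rcases hu with rfl | rfl | rfl <;> rcases hw with rfl | rfl | rfl <;> simp_all [Sym2.eq_swap]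
  | stack x y z v hG hf hv ih =>
    intro u hu w hw huw
    exact Finset.mem_union_left _ (ih u hu w hw huw)

theorem eq_out_of_card_eq_three (h : IsStacked V E out F) (hc : V.card = 3) : F = {out} := by
  cases h with
  | base => rfl
  | stack x y z v hG hf hv =>
    have := Finset.card_le_card hG.out_subset_s9
    rw [hG.out_card] at this
    rw [Finset.card_insert_of_notMem hv] at hc
    omega

/-- A stacked triangulation with an interior vertex has one adjacent to the whole outer face. -/
theorem exists_apex (h : IsStacked V E out F) (hc : 4 ≤ V.card) :
    ∃ p ∈ V, p ∉ out ∧ ∀ u ∈ out, s(p, u) ∈ E := by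
  induction h with
  | base x y z =>
    have := Finset.card_le_three (a := x) (b := y) (c := z)
    omega
  | @stack V E out F x y z v hG hf hv ih =>
    by_cases h4 : 4 ≤ V.card
    · obtain ⟨p, hp, hpo, hpe⟩ := ih h4
      exact ⟨p, Finset.mem_insert_of_mem hp, hpo, fun u hu => Finset.mem_union_left _ (hpe u hu)⟩
    · have h3 := Finset.card_le_card hG.out_subset_s9
      rw [hG.out_card] at h3
      rw [hG.eq_out_of_card_eq_three (by omega), Finset.mem_singleton] at hf
      subst hf
      refine ⟨v, Finset.mem_insert_self _ _, fun h => hv (hG.out_subset_s9 h), fun u hu => ?_⟩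
      simp only [Finset.mem_insert, Finset.mem_singleton] at hu
      rcases hu with rfl | rfl | rfl <;> simp

/-- A large enough vertex set meets every inner face. -/
theorem exists_mem_face (h : IsStacked V E out F) {S : Finset ℕ} (hS : S ⊆ V)
    (hc : V.card < S.card + 3) : ∀ f ∈ F, ∃ u ∈ S, u ∈ f := by
  intro f hf
  obtain ⟨u, hu⟩ := Finset.inter_nonempty_of_card_lt_card_add_card hS (h.face_subset f hf)
    (by rw [h.face_card f hf]; exact hc)
  exact ⟨u, (Finset.mem_inter.1 hu).1, (Finset.mem_inter.1 hu).2⟩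

/-- On six vertices, among any three of the outer vertices and an apex `p`, one can be dropped
so that the remaining three of these four vertices still meet every inner face. -/
theorem exists_apex_of_card_eq_six (h : IsStacked V E out F) (hc : V.card = 6) :
    ∃ p ∈ V, p ∉ out ∧ (∀ u ∈ out, s(p, u) ∈ E) ∧
      ∀ T ⊆ insert p out, T.card = 3 →
        ∃ t ∈ T, ∀ f ∈ F, ∃ u ∈ (insert p out).erase t, u ∈ f := by
  have h' := h
  cases h with
  | base x y z =>
    have := Finset.card_le_three (a := x) (b := y) (c := z)
    omega
  | @stack V E _ F x y z r hG hf hr =>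
    rw [Finset.card_insert_of_notMem hr] at hc
    obtain ⟨p, hp, hpo, hpe⟩ := hG.exists_apex (by omega)
    refine ⟨p, Finset.mem_insert_of_mem hp, hpo,
      fun u hu => Finset.mem_union_left _ (hpe u hu), fun T hT hT3 => ?_⟩
    have hD : insert p out ⊆ V := Finset.insert_subset hp hG.out_subset_s9
    have hDc : (insert p out).card = 4 := by rw [Finset.card_insert_of_notMem hpo, hG.out_card]
    obtain ⟨q, hqV, hqD⟩ := Finset.exists_mem_notMem_of_card_lt_card
      (s := insert p out) (t := V) (by omega)
    by_contra! hcon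
    have key : ∀ t ∈ T, q ∈ ({x, y, z} : Finset ℕ) ∧ t ∈ ({x, y, z} : Finset ℕ) := by
      intro t ht
      obtain ⟨f, hfF, hfD⟩ := hcon t ht
      have hsub : f ⊆ {t, q, r} := by
        intro u hu
        by_contra hne
        simp only [Finset.mem_insert, Finset.mem_singleton, not_or] at hne
        have huV : u ∈ V :=
          (Finset.mem_insert.1 (h'.face_subset f hfF hu)).resolve_left hne.2.2
        have huD : u ∉ insert p out := fun hm => hfD u (Finset.mem_erase.2 ⟨hne.1, hm⟩) hu
        have := Finset.card_le_card
          (Finset.insert_subset huV (Finset.insert_subset hqV hD))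
        rw [Finset.card_insert_of_notMem, Finset.card_insert_of_notMem hqD] at this
        · omega
        · rw [Finset.mem_insert]
          exact not_or.2 ⟨hne.2.1, huD⟩
      have hfeq : f = {t, q, r} := Finset.eq_of_subset_of_card_le hsub
        (by rw [h'.face_card f hfF]; exact Finset.card_le_three)
      have htr : t ≠ r := fun e => hr (e ▸ hD (hT ht))
      have hqr : q ≠ r := fun e => hr (e ▸ hqV)
      have hsubf : f ⊆ {r, x, y, z} := by
        simp only [Finset.mem_union, Finset.mem_erase, Finset.mem_insert,
          Finset.mem_singleton] at hfF
        rcases hfF with h0 | rfl | rfl | rfl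
        · exact absurd (hG.face_subset f h0.2 (by simp [hfeq])) hr
        all_goals
          intro u hu
          simp only [Finset.mem_insert, Finset.mem_singleton] at hu ⊢
          tauto
      exact ⟨(Finset.mem_insert.1 (hsubf (by simp [hfeq]))).resolve_left hqr,
        (Finset.mem_insert.1 (hsubf (by simp [hfeq]))).resolve_left htr⟩
    obtain ⟨t, ht⟩ := Finset.card_pos.1 (by omega : 0 < T.card)
    have := Finset.card_le_card
      (Finset.insert_subset (key t ht).1 (fun u hu => (key u hu).2 : T ⊆ {x, y, z}))
    rw [Finset.card_insert_of_notMem fun hm => hqD (hT hm)] at this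
    have := Finset.card_le_three (a := x) (b := y) (c := z)
    omega

/-- On six vertices, one outer vertex together with a suitable edge meets every inner face. -/
theorem exists_edge_of_card_eq_six {a b c : ℕ} (h : IsStacked V E {a, b, c} F)
    (hc : V.card = 6) :
    ∃ u w, s(u, w) ∈ E ∧ (u = b ∨ u = c) ∧ ∀ f ∈ F, a ∈ f ∨ u ∈ f ∨ w ∈ f := by
  have hbc := ne_of_card_eq_three_s9 h.out_card
  obtain ⟨p, -, hpo, hpe, hT⟩ := h.exists_apex_of_card_eq_six hc
  simp only [Finset.mem_insert, Finset.mem_singleton, not_or] at hpo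
  obtain ⟨t, ht, htf⟩ := hT {p, b, c} (by intro u; simp; tauto)
    (Finset.card_eq_three.2 ⟨p, b, c, hpo.2.1, hpo.2.2, hbc.2.2, rfl⟩)
  have hb := hpe b (by simp)
  have hc := hpe c (by simp)
  have hbcE := h.out_edge b (by simp) c (by simp) hbc.2.2
  rw [Sym2.eq_swap] at hb hc
  simp only [Finset.mem_insert, Finset.mem_singleton] at ht
  simp only [Finset.mem_erase, Finset.mem_insert, Finset.mem_singleton] at htf
  rcases ht with rfl | rfl | rfl
  · refine ⟨b, c, hbcE, Or.inl rfl, fun f hf => ?_⟩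
    obtain ⟨u, ⟨hut, rfl | rfl | rfl | rfl⟩, huf⟩ := htf f hf <;> tauto
  · refine ⟨c, p, hc, Or.inr rfl, fun f hf => ?_⟩
    obtain ⟨u, ⟨hut, rfl | rfl | rfl | rfl⟩, huf⟩ := htf f hf <;> tauto
  · refine ⟨b, p, hb, Or.inl rfl, fun f hf => ?_⟩
    obtain ⟨u, ⟨hut, rfl | rfl | rfl | rfl⟩, huf⟩ := htf f hf <;> tauto

/-- On six vertices, two outer vertices together with an edge from the third outer vertex
meet every inner face. -/
theorem exists_edge_from_of_card_eq_six {a b c : ℕ} (h : IsStacked V E {a, b, c} F)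
    (hc : V.card = 6) :
    ∃ w, s(c, w) ∈ E ∧ ∀ f ∈ F, a ∈ f ∨ b ∈ f ∨ c ∈ f ∨ w ∈ f := by
  obtain ⟨p, hp, hpo, hpe⟩ := h.exists_apex (by omega)
  refine ⟨p, Sym2.eq_swap ▸ hpe c (by simp), fun f hf => ?_⟩
  obtain ⟨u, hu, huf⟩ := h.exists_mem_face (Finset.insert_subset hp h.out_subset_s9)
    (by rw [Finset.card_insert_of_notMem hpo, h.out_card]; omega) f hf
  simp only [Finset.mem_insert, Finset.mem_singleton] at hu
  rcases hu with rfl | rfl | rfl | rfl <;> tauto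

/-- On four vertices, any two distinct outer vertices meet every inner face. -/
theorem mem_face_of_card_eq_four (h : IsStacked V E out F) (hc : V.card = 4) {a b : ℕ}
    (ha : a ∈ out) (hb : b ∈ out) (hab : a ≠ b) : ∀ f ∈ F, a ∈ f ∨ b ∈ f := by
  intro f hf
  obtain ⟨u, hu, huf⟩ := h.exists_mem_face (S := {a, b})
    (Finset.insert_subset (h.out_subset_s9 ha) (Finset.singleton_subset_iff.2 (h.out_subset_s9 hb)))
    (by rw [Finset.card_pair hab]; omega) f hf
  simp only [Finset.mem_insert, Finset.mem_singleton] at hu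
  rcases hu with rfl | rfl <;> tauto

end IsStacked

/-- Let `G` be an `8`-vertex stacked triangulation with outer face `{x,y,z}`, let `v` be
the unique vertex adjacent to all of `x,y,z`, such that the sub-triangulation of `G`
inside `{v,x,y}` has `6` vertices, `{v,y,z}` is a face of `G`, and the sub-triangulation
of `G` inside `{v,z,x}` has `4` vertices. Then any edge guard set `Γ'` of the `4`-vertex
stacked triangulation `G₀` on `{v,x,y,z}` can be extended by one edge of `G` to an edge
guard set of `G`. -/
theorem eight_vertex_extension (V WA WB : Finset ℕ) (E EA EB : Finset (Sym2 ℕ))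
    (F FA FB : Finset (Finset ℕ)) (x y z v : ℕ)
    (hG : IsStacked V E {x, y, z} F) (hn : V.card = 8)
    (hvV : v ∈ V) (hvx : s(v, x) ∈ E) (hvy : s(v, y) ∈ E) (hvz : s(v, z) ∈ E)
    (hvu : ∀ u ∈ V, s(u, x) ∈ E → s(u, y) ∈ E → s(u, z) ∈ E → u = v)
    (hA : IsStacked WA EA {v, x, y} FA) (hAcard : WA.card = 6)
    (hAE : EA ⊆ E) (hAF : FA ⊆ F)
    (hface : ({v, y, z} : Finset ℕ) ∈ F)
    (hB : IsStacked WB EB {v, z, x} FB) (hBcard : WB.card = 4)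
    (hBE : EB ⊆ E) (hBF : FB ⊆ F)
    (hV : V = WA ∪ WB) (hE : E = (EA ∪ EB) ∪ {s(y, z)})
    (hF : F = (FA ∪ FB) ∪ {{v, y, z}})
    (Γ' : Finset (Sym2 ℕ))
    (hΓ' : IsGuardSet {s(x, y), s(y, z), s(x, z), s(v, x), s(v, y), s(v, z)}
      {x, y, z} {{v, x, y}, {v, y, z}, {v, z, x}} Γ') :
    ∃ e ∈ E, IsGuardSet E {x, y, z} F (Γ' ∪ {e}) := by
  obtain ⟨hvx', hvy', hxy⟩ := ne_of_card_eq_three_s9 hA.out_card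
  obtain ⟨hvz', -, hzx⟩ := ne_of_card_eq_three_s9 hB.out_card
  have reduce : ∀ a b u w : ℕ, a ∈ gv Γ' → b ∈ gv Γ' → s(u, w) ∈ E →
      (∀ f ∈ FA, a ∈ f ∨ b ∈ f ∨ u ∈ f ∨ w ∈ f) →
      (∀ f ∈ FB, a ∈ f ∨ b ∈ f ∨ u ∈ f ∨ w ∈ f) →
      ∃ e ∈ E, IsGuardSet E {x, y, z} F (Γ' ∪ {e}) := by
    intro a b u w ha hb he hfA hfB
    have mono : gv Γ' ⊆ gv (Γ' ∪ {s(u, w)}) :=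
      fun t ⟨e, he, ht⟩ => ⟨e, Finset.mem_union_left _ he, ht⟩
    have hu : u ∈ gv (Γ' ∪ {s(u, w)}) := ⟨s(u, w), by simp, by simp⟩
    have hw : w ∈ gv (Γ' ∪ {s(u, w)}) := ⟨s(u, w), by simp, by simp⟩
    have pick : ∀ f : Finset ℕ, a ∈ f ∨ b ∈ f ∨ u ∈ f ∨ w ∈ f →
        ∃ t ∈ gv (Γ' ∪ {s(u, w)}), t ∈ f := by
      rintro f (h | h | h | h)
      exacts [⟨a, mono ha, h⟩, ⟨b, mono hb, h⟩, ⟨u, hu, h⟩, ⟨w, hw, h⟩]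
    have old : ∀ f ∈ faces {x, y, z} {{v, x, y}, {v, y, z}, {v, z, x}},
        ∃ t ∈ gv (Γ' ∪ {s(u, w)}), t ∈ f := fun f hf =>
      (hΓ'.2 f hf).imp fun t ht => ⟨mono ht.1, ht.2⟩
    refine ⟨s(u, w), he, Finset.union_subset (fun e heΓ => ?_) (by simpa using he), fun f hf => ?_⟩
    · have hyz : s(y, z) ∈ E := by simp [hE]
      have hxyE : s(x, y) ∈ E := hAE (hA.out_edge x (by simp) y (by simp) hxy)
      have hxzE : s(x, z) ∈ E := hBE (hB.out_edge x (by simp) z (by simp) hzx.symm)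
      have := hΓ'.1 heΓ
      simp only [Finset.mem_insert, Finset.mem_singleton] at this
      rcases this with rfl | rfl | rfl | rfl | rfl | rfl <;> assumption
    · rw [faces, hF] at hf
      simp only [Finset.mem_insert, Finset.mem_union, Finset.mem_singleton] at hf
      rcases hf with rfl | (h | h) | rfl
      · exact old _ (by simp [faces])
      · exact pick f (hfA f h)
      · exact pick f (hfB f h)
      · exact old _ (by simp [faces])
  obtain ⟨t, ⟨e, he, -⟩, -⟩ := hΓ'.2 {x, y, z} (by simp [faces])
  have hl : ∀ {a b}, s(a, b) ∈ Γ' → a ∈ gv Γ' := fun h => ⟨_, h, by simp⟩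
  have hr : ∀ {a b}, s(a, b) ∈ Γ' → b ∈ gv Γ' := fun h => ⟨_, h, by simp⟩
  have hvzB := hB.mem_face_of_card_eq_four hBcard (a := v) (b := z) (by simp) (by simp) hvz'
  have hvxB := hB.mem_face_of_card_eq_four hBcard (a := v) (b := x) (by simp) (by simp) hvx'
  have hzxB := hB.mem_face_of_card_eq_four hBcard (a := z) (b := x) (by simp) (by simp) hzx
  have rotate : ({v, x, y} : Finset ℕ) = {x, y, v} := by ext; simp; tauto
  have rotate' : ({v, x, y} : Finset ℕ) = {y, v, x} := by ext; simp; tauto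
  have hAx := rotate ▸ hA
  have hAy := rotate' ▸ hA
  have hcases := hΓ'.1 he
  simp only [Finset.mem_insert, Finset.mem_singleton] at hcases
  rcases hcases with rfl | rfl | rfl | rfl | rfl | rfl
  · obtain ⟨w, hw, hf⟩ := hAx.exists_edge_from_of_card_eq_six hAcard
    exact reduce x y v w (hl he) (hr he) (hAE hw) hf fun f h => by rcases hvxB f h with h | h <;> simp [h]
  · obtain ⟨u, w, hw, hu, hf⟩ := hAy.exists_edge_of_card_eq_six hAcard
    refine reduce y z u w (hl he) (hr he) (hAE hw) (fun f h => by rcases hf f h with h | h | h <;> simp [h])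
      fun f h => ?_
    rcases hu with rfl | rfl
    · rcases hvzB f h with h | h <;> simp [h]
    · rcases hzxB f h with h | h <;> simp [h]
  · obtain ⟨u, w, hw, hu, hf⟩ := hAx.exists_edge_of_card_eq_six hAcard
    exact reduce x z u w (hl he) (hr he) (hAE hw) (fun f h => by rcases hf f h with h | h | h <;> simp [h])
      fun f h => by rcases hzxB f h with h | h <;> simp [h]
  · obtain ⟨w, hw, hf⟩ := hA.exists_edge_from_of_card_eq_six hAcard
    exact reduce v x y w (hl he) (hr he) (hAE hw) hf fun f h => by rcases hvxB f h with h | h <;> simp [h]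
  · obtain ⟨w, hw, hf⟩ := hAy.exists_edge_from_of_card_eq_six hAcard
    exact reduce v y x w (hl he) (hr he) (hAE hw) (fun f h => by rcases hf f h with h | h | h <;> simp [h])
      fun f h => by rcases hvxB f h with h | h <;> simp [h]
  · obtain ⟨u, w, hw, hu, hf⟩ := hA.exists_edge_of_card_eq_six hAcard
    exact reduce v z u w (hl he) (hr he) (hAE hw) (fun f h => by rcases hf f h with h | h | h <;> simp [h])
      fun f h => by rcases hvzB f h with h | h <;> simp [h]

end Guarding
end

section
/- Let G be a stacked triangulation on exactly 9 vertices with outer face {x,y,z}, let v be the unique vertex of G adjacent to all of x, y, z, and suppose that the sub-triangulation of G inside {v,x,y} has 6 vertices, that {v,y,z} is a face of G, and that the sub-triangulation of G inside {v,z,x} has 5 vertices. Then there exists a 5-vertex stacked triangulation G' with outer face {x,y,z}, obtained by stacking two new vertices (not vertices of G) inside the triangle {x,y,z}, such that for every edge guard set Γ' of G' there exists an edge guard set Γ of G with |Γ| ≤ |Γ'| + 1. -/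
namespace Guarding

/-- Every face is a set of three vertices which are pairwise adjacent. -/
theorem IsStacked.face_spec {V : Finset ℕ} {E : Finset (Sym2 ℕ)} {out : Finset ℕ}
    {F : Finset (Finset ℕ)} (h : IsStacked V E out F) :
    ∀ f ∈ faces out F, f ⊆ V ∧ f.card = 3 ∧ ∀ a ∈ f, ∀ b ∈ f, a ≠ b → s(a, b) ∈ E := by
  induction h with
  | base x y z hxy hyz hxz =>
    intro f hf
    simp only [faces, Finset.mem_insert, Finset.mem_singleton, or_self] at hf
    subst hf
    refine ⟨subset_rfl, Finset.card_eq_three.2 ⟨x, y, z, hxy, hxz, hyz, rfl⟩, ?_⟩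
    simp only [Finset.mem_insert, Finset.mem_singleton, Sym2.eq_iff]
    grind
  | @stack V E out F x y z v hG hf hv ih =>
    obtain ⟨hsub, hcard, hadj⟩ := ih _ (Finset.mem_insert_of_mem hf)
    have hx : x ∈ V := hsub (by simp)
    have hy : y ∈ V := hsub (by simp)
    have hz : z ∈ V := hsub (by simp)
    have hne := ne_of_card_eq_three hcard
    have hxy := hadj x (by simp) y (by simp) hne.1
    have hxz := hadj x (by simp) z (by simp) hne.2.1
    have hyz := hadj y (by simp) z (by simp) hne.2.2
    have key : ∀ a b, a ∈ V → b ∈ V → a ≠ b → s(a, b) ∈ E →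
        s(v, a) ∈ E ∪ {s(v, x), s(v, y), s(v, z)} →
        s(v, b) ∈ E ∪ {s(v, x), s(v, y), s(v, z)} →
        ({v, a, b} : Finset ℕ) ⊆ insert v V ∧ ({v, a, b} : Finset ℕ).card = 3 ∧
        ∀ c ∈ ({v, a, b} : Finset ℕ), ∀ d ∈ ({v, a, b} : Finset ℕ), c ≠ d →
          s(c, d) ∈ E ∪ {s(v, x), s(v, y), s(v, z)} := by
      intro a b ha hb hab hE hva hvb
      have hE' := Finset.mem_union_left {s(v, x), s(v, y), s(v, z)} hE
      have hav : v ≠ a := fun h => hv (h ▸ ha)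
      have hbv : v ≠ b := fun h => hv (h ▸ hb)
      refine ⟨by simp [Finset.insert_subset_iff, ha, hb],
        Finset.card_eq_three.2 ⟨v, a, b, hav, hbv, hab, rfl⟩, ?_⟩
      generalize E ∪ {s(v, x), s(v, y), s(v, z)} = E' at *
      simp only [Finset.mem_insert, Finset.mem_singleton]
      rintro c (rfl | rfl | rfl) d (rfl | rfl | rfl) hcd <;>
        first | contradiction | assumption | (rw [Sym2.eq_swap]; assumption)
    intro f hf'
    simp only [faces, Finset.mem_insert, Finset.mem_union, Finset.mem_erase,
      Finset.mem_singleton] at hf'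
    have old : f ∈ faces out F → f ⊆ insert v V ∧ f.card = 3 ∧
        ∀ a ∈ f, ∀ b ∈ f, a ≠ b → s(a, b) ∈ E ∪ {s(v, x), s(v, y), s(v, z)} := by
      intro h
      obtain ⟨h₁, h₂, h₃⟩ := ih f h
      exact ⟨h₁.trans (Finset.subset_insert _ _), h₂,
        fun a ha b hb hab => Finset.mem_union_left _ (h₃ a ha b hb hab)⟩
    rcases hf' with rfl | ⟨-, h⟩ | rfl | rfl | rfl
    · exact old (Finset.mem_insert_self _ _)
    · exact old (Finset.mem_insert_of_mem h)
    · exact key x y hx hy hne.1 hxy (by simp) (by simp)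
    · exact key y z hy hz hne.2.2 hyz (by simp) (by simp)
    · exact key z x hz hx hne.2.1.symm (Sym2.eq_swap ▸ hxz) (by simp) (by simp)

theorem IsStacked.card_out {V : Finset ℕ} {E : Finset (Sym2 ℕ)} {out : Finset ℕ}
    {F : Finset (Finset ℕ)} (h : IsStacked V E out F) : out.card = 3 :=
  (h.face_spec out (Finset.mem_insert_self _ _)).2.1

theorem IsStacked.faces_eq_of_card_eq_three {V : Finset ℕ} {E : Finset (Sym2 ℕ)}
    {out : Finset ℕ} {F : Finset (Finset ℕ)} (h : IsStacked V E out F) (hV : V.card = 3) :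
    F = {out} := by
  cases h with
  | base x y z => rfl
  | stack x y z v hG hf hv =>
    have := Finset.card_le_card hG.out_subset
    rw [hG.card_out] at this
    rw [Finset.card_insert_of_notMem hv] at hV
    omega

/-- Undoing the last stacking step. Every new face consists of the new vertex `v` and all but
one of the vertices of the face `f` into which `v` has been stacked. -/
theorem IsStacked.exists_unstack {V : Finset ℕ} {E : Finset (Sym2 ℕ)} {out : Finset ℕ}
    {F : Finset (Finset ℕ)} (h : IsStacked V E out F) {n : ℕ} (hn : 3 ≤ n)
    (hV : V.card = n + 1) :
    ∃ V₀ E₀ F₀ f v, IsStacked V₀ E₀ out F₀ ∧ V₀.card = n ∧ v ∉ V₀ ∧ f ∈ F₀ ∧ E₀ ⊆ E ∧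
      ∀ g ∈ F, (g ∈ F₀ ∧ g ≠ f) ∨ ∃ w ∈ f, insert v (f.erase w) ⊆ g := by
  cases h with
  | base x y z =>
    have := Finset.card_le_three (a := x) (b := y) (c := z)
    omega
  | @stack V₀ E₀ _ F₀ x y z v hG hf hv =>
    rw [Finset.card_insert_of_notMem hv] at hV
    refine ⟨V₀, E₀, F₀, _, v, hG, by omega, hv, hf, Finset.subset_union_left, ?_⟩
    intro g hg
    simp only [Finset.mem_insert, Finset.mem_union, Finset.mem_erase,
      Finset.mem_singleton] at hg
    rcases hg with ⟨h₁, h₂⟩ | rfl | rfl | rfl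
    · exact Or.inl ⟨h₂, h₁⟩
    · exact Or.inr ⟨z, by simp, by grind⟩
    · exact Or.inr ⟨x, by simp, by grind⟩
    · exact Or.inr ⟨y, by simp, by grind⟩

theorem one_lt_card_inter_of_erase_subset {f g : Finset ℕ} {w : ℕ} (hf : f.card = 3)
    (hw : w ∈ f) (h : f.erase w ⊆ g) : 1 < (g ∩ f).card := by
  have h₁ : f.erase w ⊆ g ∩ f := Finset.subset_inter h (Finset.erase_subset _ _)
  have h₂ := Finset.card_le_card h₁
  rw [Finset.card_erase_of_mem hw] at h₂
  omega

/-- In a stacked triangulation on four vertices, any two faces have two common vertices. -/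
theorem IsStacked.one_lt_card_inter_of_card_eq_four {V : Finset ℕ} {E : Finset (Sym2 ℕ)}
    {out : Finset ℕ} {F : Finset (Finset ℕ)} (h : IsStacked V E out F) (hV : V.card = 4) :
    ∀ f ∈ faces out F, ∀ g ∈ F, 1 < (g ∩ f).card := by
  obtain ⟨V₀, E₀, F₀, f₀, v, h₀, hV₀, hv, hf₀, -, hF⟩ := h.exists_unstack le_rfl hV
  obtain rfl := h₀.faces_eq_of_card_eq_three hV₀
  rw [Finset.mem_singleton] at hf₀
  subst hf₀
  have hvo : v ∉ f₀ := fun hmem => hv (h₀.out_subset hmem)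
  have hF' : ∀ g ∈ F, ∃ w ∈ f₀, insert v (f₀.erase w) ⊆ g := by
    intro g hg
    rcases hF g hg with ⟨h₁, h₂⟩ | h₁
    · exact absurd (Finset.mem_singleton.1 h₁) h₂
    · exact h₁
  intro f hf g hg
  obtain ⟨w, hw, hwg⟩ := hF' g hg
  rcases Finset.mem_insert.1 hf with rfl | hf
  · exact one_lt_card_inter_of_erase_subset h₀.card_out hw
      ((Finset.subset_insert _ _).trans hwg)
  · obtain ⟨u, hu, huf⟩ := hF' f hf
    have hcard : 0 < ((f₀.erase w).erase u).card := by
      have h₁ := Finset.pred_card_le_card_erase (s := f₀.erase w) (a := u)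
      rw [Finset.card_erase_of_mem hw, h₀.card_out] at h₁
      omega
    obtain ⟨t, ht⟩ := Finset.card_pos.1 hcard
    simp only [Finset.mem_erase] at ht
    refine Finset.one_lt_card.2 ⟨v, ?_, t, ?_, fun h => hvo (h ▸ ht.2.2)⟩
    · exact Finset.mem_inter.2 ⟨hwg (by simp), huf (by simp)⟩
    · exact Finset.mem_inter.2 ⟨hwg (by simp [ht]), huf (by simp [ht])⟩

/-- In a stacked triangulation on five vertices, some triangle shares two vertices with the
outer face and with every inner face. -/
theorem IsStacked.exists_triangle_of_card_eq_five {V : Finset ℕ} {E : Finset (Sym2 ℕ)}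
    {out : Finset ℕ} {F : Finset (Finset ℕ)} (h : IsStacked V E out F) (hV : V.card = 5) :
    ∃ T : Finset ℕ, T.card = 3 ∧ (∀ a ∈ T, ∀ b ∈ T, a ≠ b → s(a, b) ∈ E) ∧
      1 < (T ∩ out).card ∧ ∀ g ∈ F, 1 < (g ∩ T).card := by
  obtain ⟨V₀, E₀, F₀, f₀, v, h₀, hV₀, -, hf₀, hE, hF⟩ := h.exists_unstack (by norm_num) hV
  have h₄ := h₀.one_lt_card_inter_of_card_eq_four hV₀
  obtain ⟨-, hcard, hadj⟩ := h₀.face_spec f₀ (Finset.mem_insert_of_mem hf₀)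
  refine ⟨f₀, hcard, fun a ha b hb hab => hE (hadj a ha b hb hab),
    h₄ out (Finset.mem_insert_self _ _) f₀ hf₀, fun g hg => ?_⟩
  rcases hF g hg with ⟨h₁, -⟩ | ⟨w, hw, h₁⟩
  · exact h₄ f₀ (Finset.mem_insert_of_mem hf₀) g h₁
  · exact one_lt_card_inter_of_erase_subset hcard hw ((Finset.subset_insert _ _).trans h₁)

/-- A set sharing two vertices with a three-element set `T` contains one of any two vertices
of `T`. -/
theorem mem_or_mem_of_one_lt_card_inter {g T : Finset ℕ} {i j : ℕ} (hT : T.card = 3)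
    (hi : i ∈ T) (hj : j ∈ T) (hij : i ≠ j) (h : 1 < (g ∩ T).card) : i ∈ g ∨ j ∈ g := by
  by_contra! hcon
  have h₁ : g ∩ T ⊆ (T.erase i).erase j := by grind
  have h₂ := Finset.card_le_card h₁
  rw [Finset.card_erase_of_mem (by grind), Finset.card_erase_of_mem hi] at h₂
  omega

/-- The inner faces of a stacked triangulation on five vertices are guarded by an edge of the
outer face. -/
theorem IsStacked.exists_outer_guard_of_card_eq_five {V : Finset ℕ} {E : Finset (Sym2 ℕ)}
    {out : Finset ℕ} {F : Finset (Finset ℕ)} (h : IsStacked V E out F) (hV : V.card = 5) :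
    ∃ i ∈ out, ∃ j ∈ out, i ≠ j ∧ s(i, j) ∈ E ∧ ∀ g ∈ F, i ∈ g ∨ j ∈ g := by
  obtain ⟨T, hT, hadj, hout, hF⟩ := h.exists_triangle_of_card_eq_five hV
  obtain ⟨i, hi, j, hj, hij⟩ := Finset.one_lt_card.1 hout
  rw [Finset.mem_inter] at hi hj
  exact ⟨i, hi.2, j, hj.2, hij, hadj i hi.1 j hj.1 hij,
    fun g hg => mem_or_mem_of_one_lt_card_inter hT hi.1 hj.1 hij (hF g hg)⟩

/-- The inner faces of a stacked triangulation on six vertices are guarded by one edge. -/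
theorem IsStacked.exists_guard_of_card_eq_six {V : Finset ℕ} {E : Finset (Sym2 ℕ)}
    {out : Finset ℕ} {F : Finset (Finset ℕ)} (h : IsStacked V E out F) (hV : V.card = 6) :
    ∃ i j, s(i, j) ∈ E ∧ ∀ g ∈ F, i ∈ g ∨ j ∈ g := by
  obtain ⟨V₀, E₀, F₀, f₀, v, h₀, hV₀, -, hf₀, hE, hF⟩ := h.exists_unstack (by norm_num) hV
  obtain ⟨T, hT, hadj, -, hTF⟩ := h₀.exists_triangle_of_card_eq_five hV₀
  obtain ⟨i, hi, j, hj, hij⟩ := Finset.one_lt_card.1 (hTF f₀ hf₀)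
  rw [Finset.mem_inter] at hi hj
  refine ⟨i, j, hE (hadj i hi.2 j hj.2 hij), fun g hg => ?_⟩
  rcases hF g hg with ⟨h₁, -⟩ | ⟨w, hw, h₁⟩
  · exact mem_or_mem_of_one_lt_card_inter hT hi.2 hj.2 hij (hTF g h₁)
  · have hcard := (h₀.face_spec f₀ (Finset.mem_insert_of_mem hf₀)).2.1
    exact mem_or_mem_of_one_lt_card_inter hcard hi.1 hj.1 hij
      (one_lt_card_inter_of_erase_subset hcard hw ((Finset.subset_insert _ _).trans h₁))

theorem IsGuardSet.nonempty {E : Finset (Sym2 ℕ)} {out : Finset ℕ} {F : Finset (Finset ℕ)}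
    {Γ : Finset (Sym2 ℕ)} (h : IsGuardSet E out F Γ) : Γ.Nonempty := by
  obtain ⟨u, ⟨e, he, -⟩, -⟩ := h.2 out (Finset.mem_insert_self _ _)
  exact ⟨e, he⟩

/-- Any triangle extends to a five-vertex stacked triangulation whose inner vertices avoid a
given finite set. -/
theorem exists_isStacked_card_eq_five {x y z : ℕ} (hxy : x ≠ y) (hyz : y ≠ z) (hxz : x ≠ z)
    {V : Finset ℕ} (hV : {x, y, z} ⊆ V) :
    ∃ V' E' F', IsStacked V' E' {x, y, z} F' ∧ V'.card = 5 ∧ V' ∩ V = {x, y, z} := by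
  obtain ⟨p, hp⟩ := Infinite.exists_notMem_finset V
  obtain ⟨q, hq⟩ := Infinite.exists_notMem_finset (insert p V)
  have hp' : p ∉ ({x, y, z} : Finset ℕ) := fun h => hp (hV h)
  have hq' : q ∉ insert p ({x, y, z} : Finset ℕ) :=
    fun h => hq (Finset.insert_subset_insert _ hV h)
  have h₄ := IsStacked.stack x y z p (.base x y z hxy hyz hxz)
    (Finset.mem_singleton_self _) hp'
  have h₅ := IsStacked.stack p x y q h₄ (by simp) hq'
  refine ⟨_, _, _, h₅, ?_, ?_⟩
  · rw [Finset.card_insert_of_notMem hq', Finset.card_insert_of_notMem hp',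
      Finset.card_eq_three.2 ⟨x, y, z, hxy, hxz, hyz, rfl⟩]
  · rw [Finset.mem_insert, not_or] at hq
    rw [Finset.insert_inter_of_notMem hq.2, Finset.insert_inter_of_notMem hp,
      Finset.inter_eq_left.2 hV]

/-- Let `G` be a `9`-vertex stacked triangulation with outer face `{x,y,z}`, let `v` be
the unique vertex adjacent to all of `x,y,z`, such that the sub-triangulation of `G`
inside `{v,x,y}` has `6` vertices, `{v,y,z}` is a face of `G`, and the sub-triangulation
of `G` inside `{v,z,x}` has `5` vertices. Then there is a `5`-vertex stacked
triangulation `G'` with outer face `{x,y,z}`, obtained by stacking two new vertices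
inside `{x,y,z}`, such that any edge guard set `Γ'` of `G'` yields an edge guard set of
`G` of size at most `|Γ'| + 1`. -/
theorem nine_vertex_reduction (V WA WB : Finset ℕ) (E EA EB : Finset (Sym2 ℕ))
    (F FA FB : Finset (Finset ℕ)) (x y z v : ℕ)
    (hG : IsStacked V E {x, y, z} F) (hn : V.card = 9)
    (hvV : v ∈ V) (hvx : s(v, x) ∈ E) (hvy : s(v, y) ∈ E) (hvz : s(v, z) ∈ E)
    (hvu : ∀ u ∈ V, s(u, x) ∈ E → s(u, y) ∈ E → s(u, z) ∈ E → u = v)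
    (hA : IsStacked WA EA {v, x, y} FA) (hAcard : WA.card = 6)
    (hAE : EA ⊆ E) (hAF : FA ⊆ F)
    (hface : ({v, y, z} : Finset ℕ) ∈ F)
    (hB : IsStacked WB EB {v, z, x} FB) (hBcard : WB.card = 5)
    (hBE : EB ⊆ E) (hBF : FB ⊆ F)
    (hV : V = WA ∪ WB) (hE : E = (EA ∪ EB) ∪ {s(y, z)})
    (hF : F = (FA ∪ FB) ∪ {{v, y, z}}) :
    ∃ (V' : Finset ℕ) (E' : Finset (Sym2 ℕ)) (F' : Finset (Finset ℕ)),
      IsStacked V' E' {x, y, z} F' ∧ V'.card = 5 ∧ V' ∩ V = {x, y, z} ∧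
      ∀ Γ' : Finset (Sym2 ℕ), IsGuardSet E' {x, y, z} F' Γ' →
        ∃ Γ : Finset (Sym2 ℕ), IsGuardSet E {x, y, z} F Γ ∧ Γ.card ≤ Γ'.card + 1 := by
  have hxyz := ne_of_card_eq_three hG.card_out
  obtain ⟨V', E', F', hG', hcard, hinter⟩ :=
    exists_isStacked_card_eq_five hxyz.1 hxyz.2.2 hxyz.2.1 hG.out_subset
  refine ⟨V', E', F', hG', hcard, hinter, fun Γ' hΓ' => ?_⟩
  obtain ⟨a, b, hab, habF⟩ := hA.exists_guard_of_card_eq_six hAcard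
  obtain ⟨i, hi, j, hj, hij, hijE, hijF⟩ := hB.exists_outer_guard_of_card_eq_five hBcard
  refine ⟨{s(a, b), s(i, j)}, ⟨?_, ?_⟩, ?_⟩
  · intro e he
    rcases Finset.mem_insert.1 he with rfl | he
    · exact hAE hab
    · exact Finset.mem_singleton.1 he ▸ hBE hijE
  · have hgv : ∀ u, u = a ∨ u = b ∨ u = i ∨ u = j →
        u ∈ gv ({s(a, b), s(i, j)} : Finset (Sym2 ℕ)) := by
      rintro u (rfl | rfl | rfl | rfl) <;> simp [gv]
    suffices h : ∀ f ∈ faces {x, y, z} F, a ∈ f ∨ b ∈ f ∨ i ∈ f ∨ j ∈ f by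
      intro f hf
      rcases h f hf with h | h | h | h
      · exact ⟨a, hgv a (by simp), h⟩
      · exact ⟨b, hgv b (by simp), h⟩
      · exact ⟨i, hgv i (by simp), h⟩
      · exact ⟨j, hgv j (by simp), h⟩
    intro f hf
    simp only [faces, hF, Finset.mem_insert, Finset.mem_union, Finset.mem_singleton] at hf
    have hcorner : ∀ f : Finset ℕ, z ∈ f → (x ∈ f ∨ v ∈ f) → i ∈ f ∨ j ∈ f := by
      clear * - hi hj hij
      simp only [Finset.mem_insert, Finset.mem_singleton] at hi hj
      grind
    rcases hf with rfl | (hf | hf) | rfl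
    · exact Or.inr (Or.inr (hcorner _ (by simp) (by simp)))
    · exact (habF f hf).imp_right Or.inl
    · exact Or.inr (Or.inr (hijF f hf))
    · exact Or.inr (Or.inr (hcorner _ (by simp) (by simp)))
  · exact Finset.card_le_two.trans (Nat.succ_le_succ (Finset.card_pos.2 hΓ'.nonempty))

end Guarding
end
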